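/- arXiv:math/0110096 — 2 statements merged into one kernel-verified Lean document; each statement's English description precedes it below -/
import Mathlib

section
/- For any nonzero finitely generated ℤ^d-graded k[Q]-module M, there exists β ∈ ℤ^d such that M_β ≠ 0 and, for all γ ∈ β + Q, the inclusion of ℤ^d-graded degree-γ components M_γ ↪ E(M)_γ into the ℤ^d-graded injective hull E(M) of M is an isomorphism of k-vector spaces. -/
attribute [local instance] Classical.propDecidable

set_option synthInstance.maxHeartbeats 1000000
set_option maxHeartbeats 4000000

noncomputable section

open DirectSum

namespace ZMS

/-- The ambient lattice `ℤ^d`. -/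
abbrev L (d : ℕ) : Type := Fin d → ℤ

variable (k : Type) [Field k] {d : ℕ} (Q : AddSubmonoid (L d))

/-- `Q ⊆ ℤ^d` is a normal affine semigroup. -/
structure IsNormalAffineSemigroup (Q : AddSubmonoid (L d)) : Prop where
  fg : Q.FG
  generates : AddSubgroup.closure (Q : Set (L d)) = ⊤
  pointed : ∀ x ∈ Q, -x ∈ Q → x = 0
  saturated : ∀ (x : L d) (n : ℕ), 0 < n → n • x ∈ Q → x ∈ Q

/-- The affine semigroup ring `k[Q]`. -/
abbrev kQ : Type := AddMonoidAlgebra k Q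

/-- The monomial `x^q` in `k[Q]`. -/
def mono (q : Q) : kQ k Q := AddMonoidAlgebra.single q 1

/-- A monomial (i.e. `ℤ^d`-graded) ideal of `k[Q]`. -/
def IsMonomialIdeal (W : Ideal (kQ k Q)) : Prop :=
  ∃ S : Set Q, W = Ideal.span (mono k Q '' S)

/-- An ideal is irreducible if it is not the intersection of two ideals
properly containing it. -/
def IsIrreducibleIdeal (W : Ideal (kQ k Q)) : Prop :=
  ∀ W₁ W₂ : Ideal (kQ k Q), W = W₁ ⊓ W₂ → W = W₁ ∨ W = W₂

/-- A face of `Q`: the zero set in `Q` of a linear functional nonnegative on `Q`. -/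
def IsFace (F : AddSubmonoid (L d)) : Prop :=
  ∃ lam : L d →ₗ[ℤ] ℤ, (∀ x ∈ Q, 0 ≤ lam x) ∧
    (F : Set (L d)) = {x | x ∈ Q ∧ lam x = 0}

/-- The dimension of (the real cone spanned by) a face. -/
def faceDim (F : AddSubmonoid (L d)) : ℕ :=
  Module.finrank ℤ (AddSubgroup.closure (F : Set (L d)))

/-- `G'` is a facet of `G`. -/
def IsFacetOf (G' G : AddSubmonoid (L d)) : Prop :=
  IsFace Q G' ∧ IsFace Q G ∧ G' ≤ G ∧ faceDim G' + 1 = faceDim G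

/-- The monomial prime ideal of the face `F`, i.e. the kernel of `k[Q] → k[F]`. -/
def facePrime (F : AddSubmonoid (L d)) : Ideal (kQ k Q) :=
  Ideal.span {m | ∃ q : Q, (q : L d) ∉ F ∧ m = mono k Q q}

lemma facePrime_mono {F G : AddSubmonoid (L d)} (h : G ≤ F) :
    facePrime k Q F ≤ facePrime k Q G := by
  apply Ideal.span_mono
  rintro m ⟨q, hq, rfl⟩
  exact ⟨q, fun hm => hq (h hm), rfl⟩

/-- The semigroup ring `k[F]` of a face `F`, as a quotient of `k[Q]`. -/
abbrev faceRing (F : AddSubmonoid (L d)) : Type := kQ k Q ⧸ facePrime k Q F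

/-- The `k[Q]`-linear quotient map between quotients of `k[Q]`. -/
def fMap {I J : Ideal (kQ k Q)} (h : I ≤ J) :
    (kQ k Q ⧸ I) →ₗ[kQ k Q] (kQ k Q ⧸ J) :=
  Submodule.mapQ _ _ LinearMap.id (by simpa using h)

/-- Lattice points in the relative interior of a face `F`. -/
def relint (F : AddSubmonoid (L d)) : Set (L d) :=
  {a | a ∈ F ∧ ∀ G, IsFace Q G → G ≤ F → G ≠ F → a ∉ G}

/-- The canonical module `ω_{k[F]}`, the span in `k[F]` of the monomials whose
exponents lie in the relative interior of `F`. -/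
def canonicalModule (F : AddSubmonoid (L d)) : Submodule (kQ k Q) (faceRing k Q F) :=
  Submodule.span (kQ k Q)
    {x | ∃ q : Q, (q : L d) ∈ relint Q F ∧ x = Ideal.Quotient.mk (facePrime k Q F) (mono k Q q)}

/-- The `ℤ^d`-degree-`a` component of a quotient of `k[Q]` by a monomial ideal. -/
def quotDeg (W : Ideal (kQ k Q)) (a : L d) : Submodule k (kQ k Q ⧸ W) :=
  Submodule.span k {x | ∃ q : Q, (q : L d) = a ∧ x = Ideal.Quotient.mk W (mono k Q q)}

/-- Isomorphism of `ℤ^d`-graded `k[Q]`-modules between the quotients of `k[Q]` by two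
monomial ideals. -/
def GradedQuotIso (W W' : Ideal (kQ k Q)) : Prop :=
  ∃ e : (kQ k Q ⧸ W) ≃ₗ[kQ k Q] (kQ k Q ⧸ W'),
    (∀ (a : L d) (x), x ∈ quotDeg k Q W a → e x ∈ quotDeg k Q W' a) ∧
    (∀ (a : L d) (x), x ∈ quotDeg k Q W' a → e.symm x ∈ quotDeg k Q W a)

/-- The `ℤ^d`-degree-`a` component of a direct sum of quotients of `k[Q]` by
monomial ideals. -/
def sumDeg {ι : Type} (W : ι → Ideal (kQ k Q)) (a : L d) :
    Submodule k (⨁ j, kQ k Q ⧸ W j) :=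
  Submodule.span k {x | ∃ (q : Q) (j : ι), (q : L d) = a ∧
    x = DirectSum.lof (kQ k Q) ι (fun j => kQ k Q ⧸ W j) j
          (Ideal.Quotient.mk (W j) (mono k Q q))}


section Injectives

/-- The set `α + E_F = {α + f - a | f ∈ F, a ∈ Q}` of exponents of the
indecomposable injective `k{α + E_F}`. -/
def EFset (α : L d) (F : AddSubmonoid (L d)) : Set (L d) :=
  {b | ∃ f ∈ F, ∃ a ∈ Q, b = α + f - a}

/-- Relations presenting the `k[Q]`-module `k{S}` spanned by the monomials with
exponents in `S` (for `S` closed under subtracting `Q`), with the truncated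
action: `x^q ⬝ x^s = x^{s+q}` if `s+q ∈ S` and `0` otherwise. -/
def injRel (S : Set (L d)) : Submodule (kQ k Q) (⨁ _s : S, kQ k Q) :=
  Submodule.span (kQ k Q)
    ({x | ∃ (s t : S) (q : Q), (t : L d) = (s : L d) + (q : L d) ∧
        x = mono k Q q • DirectSum.lof (kQ k Q) S (fun _ => kQ k Q) s 1 -
            DirectSum.lof (kQ k Q) S (fun _ => kQ k Q) t 1} ∪
     {x | ∃ (s : S) (q : Q), ((s : L d) + (q : L d)) ∉ S ∧
        x = mono k Q q • DirectSum.lof (kQ k Q) S (fun _ => kQ k Q) s 1})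

/-- The `k[Q]`-module `k{S}`; for `S = α + E_F` this is the indecomposable
`ℤ^d`-graded injective `k{α + E_F}`. -/
abbrev injMod (S : Set (L d)) : Type := (⨁ _s : S, kQ k Q) ⧸ injRel k Q S

/-- The monomial basis element `x^s` of `k{S}`. -/
def injMono (S : Set (L d)) (s : S) : injMod k Q S :=
  Submodule.Quotient.mk (DirectSum.lof (kQ k Q) S (fun _ => kQ k Q) s 1)

/-- The `ℤ^d`-degree-`a` component of a direct sum `⊕_j k{S_j}`. -/
def injSumDeg {ι : Type} (SS : ι → Set (L d)) (a : L d) :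
    Submodule k (⨁ j, injMod k Q (SS j)) :=
  Submodule.span k {x | ∃ (j : ι) (s : SS j), (s : L d) = a ∧
    x = DirectSum.lof (kQ k Q) ι (fun j => injMod k Q (SS j)) j (injMono k Q (SS j) s)}

/-- The `Q`-graded part `N_Q = ⊕_{a ∈ Q} N_a` of a direct sum `⊕_j k{S_j}` of
indecomposable injectives. -/
def injQPart {ι : Type} (SS : ι → Set (L d)) :
    Submodule (kQ k Q) (⨁ j, injMod k Q (SS j)) :=
  Submodule.span (kQ k Q) {x | ∃ (j : ι) (s : SS j), (s : L d) ∈ Q ∧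
    x = DirectSum.lof (kQ k Q) ι (fun j => injMod k Q (SS j)) j (injMono k Q (SS j) s)}

/-- A submodule of `⊕_j k{S_j}` is `ℤ^d`-graded when it is generated by its
homogeneous elements. -/
def IsGradedSub {ι : Type} (SS : ι → Set (L d)) (N : Submodule (kQ k Q) (⨁ j, injMod k Q (SS j))) : Prop :=
  N = Submodule.span (kQ k Q) {x | x ∈ N ∧ ∃ a : L d, x ∈ injSumDeg k Q SS a}

/-- The quotient `k[Q]/W` by the irreducible monomial ideal corresponding to the
`Q`-graded part of `k{α + E_F}`: it is spanned by the monomials `x^q` with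
`q ∈ Q ∖ (α + E_F)`, and `k[Q]/W` is canonically the `Q`-graded part of
`k{α + E_F}` (both have monomial basis `Q ∩ (α + E_F)` with truncated action). -/
def coEFIdeal (α : L d) (F : AddSubmonoid (L d)) : Ideal (kQ k Q) :=
  Ideal.span {m | ∃ q : Q, (q : L d) ∉ EFset Q α F ∧ m = mono k Q q}

end Injectives


/-- coefficient functional on the free cover -/
def coefFree (S : Set (L d)) (b : L d) : (⨁ _s : S, kQ k Q) →ₗ[k] k :=
  DirectSum.toModule k S k (fun s =>
    (Finsupp.lsum k (fun q : Q => if b ∈ S ∧ (s : L d) + (q : L d) = b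
      then (LinearMap.id : k →ₗ[k] k) else 0)) ∘ₗ
      (AddMonoidAlgebra.coeffLinearEquiv k).toLinearMap)

lemma coefFree_single (S : Set (L d)) (b : L d) (s : S) (q : Q) (c : k) :
    coefFree k Q S b (DirectSum.lof (kQ k Q) S (fun _ => kQ k Q) s
      (AddMonoidAlgebra.single q c)) = if b ∈ S ∧ (s : L d) + (q : L d) = b then c else 0 := by
  have : DirectSum.lof (kQ k Q) S (fun _ => kQ k Q) s (AddMonoidAlgebra.single q c)
    = DirectSum.lof k S (fun _ => kQ k Q) s (AddMonoidAlgebra.single q c) := rfl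
  rw [this, coefFree, DirectSum.toModule_lof]
  simp
  split_ifs <;> simp

lemma coefFree_injRel (S : Set (L d)) (hS : ∀ b (q : Q), b + (q : L d) ∈ S → b ∈ S) (b : L d)
    (x) (hx : x ∈ injRel k Q S) : coefFree k Q S b x = 0 := by
  have key : ∀ (r : kQ k Q) (s : S), r • DirectSum.lof (kQ k Q) S (fun _ => kQ k Q) s 1 =
      DirectSum.lof (kQ k Q) S (fun _ => kQ k Q) s r := by
    intro r s
    rw [← map_smul, smul_eq_mul, mul_one]
  refine Submodule.closure_induction (p := fun x _ => coefFree k Q S b x = 0) ?_ ?_ ?_ hx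
  · simp
  · intro x y _ _ hx hy
    rw [map_add, hx, hy, add_zero]
  · intro r x hx
    induction r using AddMonoidAlgebra.induction_linear with
    | zero => simp
    | add f g hf hg => rw [add_smul, map_add, hf, hg, add_zero]
    | single q' c =>
      rcases hx with ⟨s, t, q, hst, rfl⟩ | ⟨s, q, hq, rfl⟩
      · rw [smul_sub, smul_smul, key, key, mono, AddMonoidAlgebra.single_mul_single, map_sub,
          coefFree_single, coefFree_single, hst]
        have : (s : L d) + ((q' + q : Q) : L d) = s + (q : L d) + (q' : L d) := by
          push_cast; abel
        rw [this]; simp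
      · rw [smul_smul, key, mono, AddMonoidAlgebra.single_mul_single, coefFree_single, if_neg]
        rintro ⟨hb, h⟩
        apply hq
        apply hS _ q'
        rw [← h] at hb
        convert hb using 1
        push_cast; abel

def coefInj (S : Set (L d)) (hS : ∀ b (q : Q), b + (q : L d) ∈ S → b ∈ S) (b : L d) :
    injMod k Q S →ₗ[k] k :=
  ((injRel k Q S).restrictScalars k).liftQ (coefFree k Q S b)
    (fun x hx => coefFree_injRel k Q S hS b x hx)

lemma coefInj_mono (S : Set (L d)) (hS) (b : L d) (s : S) :
    coefInj k Q S hS b (injMono k Q S s) = if (s : L d) = b then 1 else 0 := by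
  have : coefInj k Q S hS b (injMono k Q S s) =
    coefFree k Q S b (DirectSum.lof (kQ k Q) S (fun _ => kQ k Q) s 1) := rfl
  rw [this, AddMonoidAlgebra.one_def, coefFree_single]
  have : ((0 : Q) : L d) = 0 := rfl
  rw [this, add_zero]
  by_cases h : (s : L d) = b
  · rw [if_pos ⟨h ▸ s.2, h⟩, if_pos h]
  · rw [if_neg (fun h' => h h'.2), if_neg h]

lemma g_smul_zero {R V : Type} [Semiring R] [AddCommMonoid V] [Module R V] (c : R) :
    c • (0 : V) = 0 := smul_zero c
lemma g_zero_smul {R V : Type} [Semiring R] [AddCommMonoid V] [Module R V] (y : V) :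
    (0 : R) • y = 0 := zero_smul R y
lemma g_smul_sum {R V : Type} [Semiring R] [AddCommMonoid V] [Module R V] {n : ℕ} (c : R)
    (g : Fin n → V) : c • ∑ j, g j = ∑ j, c • g j := Finset.smul_sum

section eb
variable {n : ℕ} (SS : Fin n → Set (L d))

lemma kzero_smul (y : ⨁ j, injMod k Q (SS j)) : (0 : k) • y = 0 := zero_smul k y
lemma kone_smul (y : ⨁ j, injMod k Q (SS j)) : (1 : k) • y = y := one_smul k y
lemma ksmul_zero (c : k) : c • (0 : ⨁ j, injMod k Q (SS j)) = 0 :=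
  g_smul_zero (V := ⨁ j, injMod k Q (SS j)) c
lemma has (c e : k) (y : ⨁ j, injMod k Q (SS j)) : (c + e) • y = c • y + e • y := add_smul c e y
lemma hms (c e : k) (y : ⨁ j, injMod k Q (SS j)) : (c * e) • y = c • e • y := mul_smul c e y
lemma hss (c : k) (g : Fin n → ⨁ j, injMod k Q (SS j)) : c • ∑ j, g j = ∑ j, c • g j :=
  g_smul_sum c g
lemma hsa (g g' : Fin n → ⨁ j, injMod k Q (SS j)) :
    ∑ j, (g j + g' j) = ∑ j, g j + ∑ j, g' j :=
  Finset.sum_add_distrib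
lemma rzero_smul (y : ⨁ j, injMod k Q (SS j)) : (0 : kQ k Q) • y = 0 :=
  g_zero_smul (R := kQ k Q) (V := ⨁ j, injMod k Q (SS j)) y
lemma rsmul_zero (c : kQ k Q) : c • (0 : ⨁ j, injMod k Q (SS j)) = 0 :=
  g_smul_zero (V := ⨁ j, injMod k Q (SS j)) c
lemma hras (c e : kQ k Q) (y : ⨁ j, injMod k Q (SS j)) : (c + e) • y = c • y + e • y :=
  add_smul c e y

/-- total monomial basis element -/
def eb (j : Fin n) (b : L d) : ⨁ j, injMod k Q (SS j) :=
  if h : b ∈ SS j then DirectSum.lof (kQ k Q) (Fin n) (fun j => injMod k Q (SS j)) j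
    (injMono k Q (SS j) ⟨b, h⟩) else 0

lemma eb_neg (j : Fin n) (b : L d) (h : b ∉ SS j) : eb k Q SS j b = 0 := by
  rw [eb, dif_neg h]

lemma mono_smul_eb (hS : ∀ j b (q : Q), b + (q : L d) ∈ SS j → b ∈ SS j) (j : Fin n) (b : L d)
    (q : Q) : mono k Q q • eb k Q SS j b = eb k Q SS j (b + q) := by
  by_cases h : b ∈ SS j
  · by_cases h' : b + (q : L d) ∈ SS j
    · rw [eb, eb, dif_pos h, dif_pos h', ← map_smul]
      congr 1
      rw [injMono, injMono, ← Submodule.Quotient.mk_smul, Submodule.Quotient.eq]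
      exact Submodule.subset_span (Or.inl ⟨⟨b, h⟩, ⟨_, h'⟩, q, rfl, rfl⟩)
    · rw [eb, eb, dif_pos h, dif_neg h', ← map_smul]
      have : mono k Q q • injMono k Q (SS j) ⟨b, h⟩ = 0 := by
        rw [injMono, ← Submodule.Quotient.mk_smul, Submodule.Quotient.mk_eq_zero]
        exact Submodule.subset_span (Or.inr ⟨⟨b, h⟩, q, h', rfl⟩)
      rw [this, map_zero]
  · rw [eb, eb, dif_neg h, dif_neg (fun h' => h (hS _ _ _ h')), rsmul_zero]

lemma injSumDeg_eq (a : L d) : injSumDeg k Q SS a =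
    Submodule.span k (Set.range fun j => eb k Q SS j a) := by
  apply le_antisymm
  · apply Submodule.span_le.2
    rintro x ⟨j, s, rfl, rfl⟩
    apply Submodule.subset_span
    refine ⟨j, ?_⟩
    dsimp only
    rw [eb, dif_pos s.2]
    congr!
  · apply Submodule.span_le.2
    rintro x ⟨j, rfl⟩
    by_cases h : a ∈ SS j
    · apply Submodule.subset_span
      refine ⟨j, ⟨a, h⟩, rfl, ?_⟩
      dsimp only
      rw [eb, dif_pos h]
      congr!
    · simp [eb, h]

/-- coefficient functional -/
def coef (hS : ∀ j b (q : Q), b + (q : L d) ∈ SS j → b ∈ SS j) (j : Fin n) (b : L d) :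
    (⨁ j, injMod k Q (SS j)) →ₗ[k] k :=
  coefInj k Q (SS j) (hS j) b ∘ₗ DirectSum.component k (Fin n) (fun j => injMod k Q (SS j)) j

lemma coef_eb (hS) (j i : Fin n) (b a : L d) : coef k Q SS hS j b (eb k Q SS i a) =
    if i = j ∧ a = b ∧ b ∈ SS j then 1 else 0 := by
  by_cases h : a ∈ SS i
  · rw [eb, dif_pos h]
    by_cases hij : i = j
    · subst hij
      have : coef k Q SS hS i b (DirectSum.lof (kQ k Q) (Fin n) (fun j => injMod k Q (SS j)) i
        (injMono k Q (SS i) ⟨a, h⟩)) = coefInj k Q (SS i) (hS i) b (injMono k Q (SS i) ⟨a, h⟩) := by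
        rw [coef, LinearMap.comp_apply]
        congr 1
        exact DirectSum.component.lof_self k i _
      rw [this, coefInj_mono]
      by_cases hab : a = b
      · subst hab; simp [h]
      · simp [hab]
    · rw [if_neg (fun h => hij h.1), coef, LinearMap.comp_apply]
      have := DirectSum.component.of k (M := fun j => injMod k Q (SS j)) j i
        (injMono k Q (SS i) ⟨a, h⟩)
      rw [dif_neg hij] at this
      erw [this]
      rw [map_zero]
  · rw [eb, dif_neg h, map_zero, if_neg]
    rintro ⟨rfl, rfl, h'⟩
    exact h h'

lemma coef_deg_ne (hS) (j : Fin n) (a b : L d) (hab : a ≠ b) (x) (hx : x ∈ injSumDeg k Q SS a) :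
    coef k Q SS hS j b x = 0 := by
  rw [injSumDeg_eq] at hx
  have : Submodule.span k (Set.range fun j => eb k Q SS j a) ≤
      LinearMap.ker (coef k Q SS hS j b) := by
    apply Submodule.span_le.2
    rintro x ⟨i, rfl⟩
    simp [coef_eb, hab]
  exact this hx

lemma deg_expand (hS) (a : L d) (x) (hx : x ∈ injSumDeg k Q SS a) :
    x = ∑ j, coef k Q SS hS j a x • eb k Q SS j a := by
  rw [injSumDeg_eq] at hx
  induction hx using Submodule.span_induction with
  | mem x hx =>
    obtain ⟨i, rfl⟩ := hx
    simp only [coef_eb]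
    rw [Finset.sum_eq_single i]
    · by_cases h : a ∈ SS i
      · rw [if_pos (by simp [h]), kone_smul]
      · rw [eb, dif_neg h, ksmul_zero]
    · intro j _ hj
      rw [if_neg (fun h => hj h.1.symm), kzero_smul]
    · simp
  | zero =>
    symm
    apply Finset.sum_eq_zero
    intro j _
    rw [map_zero, kzero_smul]
  | add x y _ _ hx hy =>
    simp only [map_add, has, hsa]
    rw [← hx, ← hy]
  | smul c x _ hx =>
    simp only [map_smul, smul_eq_mul, hms]
    rw [← hss, ← hx]

lemma coef_smul_eb (hS) (j i : Fin n) (a b : L d) (r : kQ k Q)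
    (h : coef k Q SS hS j b (r • eb k Q SS i a) ≠ 0) : i = j ∧ ∃ q : Q, a + (q : L d) = b := by
  induction r using AddMonoidAlgebra.induction_linear with
  | zero => exact absurd (by rw [rzero_smul, map_zero]) h
  | add f g hf hg =>
    by_cases hf' : coef k Q SS hS j b (f • eb k Q SS i a) = 0
    · rw [hras, map_add, hf', zero_add] at h
      exact hg h
    · exact hf hf'
  | single q c =>
    have : AddMonoidAlgebra.single q c = c • mono k Q q := by simp [mono]
    rw [this, smul_assoc, map_smul, mono_smul_eb k Q SS hS, coef_eb] at h
    by_cases hc : i = j ∧ a + (q : L d) = b ∧ b ∈ SS j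
    · exact ⟨hc.1, q, hc.2.1⟩
    · rw [if_neg hc] at h; simp at h

lemma eb_ne_zero (hS : ∀ j b (q : Q), b + (q : L d) ∈ SS j → b ∈ SS j)
    (j : Fin n) (b : L d) (h : b ∈ SS j) : eb k Q SS j b ≠ 0 := by
  intro h0
  have := coef_eb k Q SS hS j j b b
  rw [h0] at this
  simp [h] at this

lemma ess_step (hS : ∀ j b (q : Q), b + (q : L d) ∈ SS j → b ∈ SS j)
    (M : Type) [AddCommGroup M] [Module (kQ k Q) M] [Module k M]
    [IsScalarTower k (kQ k Q) M]
    (degM : L d → Submodule k M)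
    (hint : DirectSum.IsInternal degM)
    (emb : M →ₗ[kQ k Q] ⨁ j : Fin n, injMod k Q (SS j))
    (hdeg : ∀ (a : L d) (m : M), m ∈ degM a → emb m ∈ injSumDeg k Q SS a)
    (hess : ∀ N : Submodule (kQ k Q) (⨁ j : Fin n, injMod k Q (SS j)),
      IsGradedSub k Q SS N → N ≠ ⊥ → N ⊓ LinearMap.range emb ≠ ⊥)
    (i : Fin n) (b : L d) (hb : b ∈ SS i) :
    ∃ q : Q, b + (q : L d) ∈ SS i ∧ ∃ m ∈ degM (b + q), emb m = eb k Q SS i (b + q) := by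
  have hN := hess (Submodule.span (kQ k Q) {eb k Q SS i b}) (by
    apply le_antisymm
    · apply Submodule.span_mono
      rintro x rfl
      refine ⟨Submodule.mem_span_singleton_self _, b, ?_⟩
      rw [injSumDeg_eq]
      exact Submodule.subset_span ⟨i, rfl⟩
    · apply Submodule.span_le.2
      rintro x ⟨hx, _⟩
      exact hx) (by
    rw [Ne, Submodule.span_singleton_eq_bot]
    exact eb_ne_zero k Q SS hS i b hb)
  obtain ⟨y, ⟨hy1, ⟨m, rfl⟩⟩, hy0⟩ := Submodule.exists_mem_ne_zero_of_ne_bot hN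
  obtain ⟨r, hr⟩ := Submodule.mem_span_singleton.1 hy1
  have hm : m ∈ ⨆ a, degM a := by rw [hint.submodule_iSup_eq_top]; trivial
  obtain ⟨f, hf, hfm⟩ := (Submodule.mem_iSup_iff_exists_finsupp _ _).1 hm
  have hcomp : ∀ j a, coef k Q SS hS j a (emb (f a)) = coef k Q SS hS j a (emb m) := by
    intro j a
    rw [← hfm, Finsupp.sum, map_sum, map_sum, Finset.sum_eq_single a]
    · intro c _ hca
      exact coef_deg_ne k Q SS hS j c a hca _ (hdeg _ _ (hf c))
    · intro ha
      rw [Finsupp.notMem_support_iff.1 ha]; simp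
  obtain ⟨a, ha⟩ : ∃ a, emb (f a) ≠ 0 := by
    by_contra! hcon
    apply hy0
    rw [← hfm, Finsupp.sum, map_sum]
    exact Finset.sum_eq_zero (fun a _ => hcon a)
  have hexp := deg_expand k Q SS hS a _ (hdeg a _ (hf a))
  have hexp' : emb (f a) = coef k Q SS hS i a (emb (f a)) • eb k Q SS i a := by
    rw [Finset.sum_eq_single i] at hexp
    · exact hexp
    · intro j _ hj
      rw [hcomp, ← hr]
      by_cases h0 : coef k Q SS hS j a (r • eb k Q SS i b) = 0
      · rw [h0, kzero_smul]
      · exact absurd (coef_smul_eb k Q SS hS j i b a r h0).1.symm hj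
    · simp
  have hc : coef k Q SS hS i a (emb (f a)) ≠ 0 := by
    intro h0
    rw [h0, kzero_smul] at hexp'
    exact ha hexp'
  have hc2 := hc
  rw [hcomp, ← hr] at hc2
  obtain ⟨_, q, rfl⟩ := coef_smul_eb k Q SS hS i i b _ r hc2
  refine ⟨q, ?_, (coef k Q SS hS i (b + q) (emb (f (b + q))))⁻¹ • f (b + q),
    Submodule.smul_mem _ _ (hf _), ?_⟩
  · by_contra h
    apply ha
    rw [hexp', eb, dif_neg h, ksmul_zero]
  · rw [LinearMap.map_smul_of_tower]
    generalize coef k Q SS hS i (b + q) (emb (f (b + q))) = c at hc hexp' ⊢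
    rw [hexp', ← hms, inv_mul_cancel₀ hc, kone_smul]
end eb

lemma EFset_down (α : L d) (F : AddSubmonoid (L d)) (b : L d) (q : Q)
    (h : b + (q : L d) ∈ EFset Q α F) : b ∈ EFset Q α F := by
  obtain ⟨f, hf, a, ha, h⟩ := h
  exact ⟨f, hf, a + q, Q.add_mem ha q.2, by rw [← sub_sub, ← h]; abel⟩

/-- For any nonzero finitely generated `ℤ^d`-graded `k[Q]`-module
`M`, there is a `β ∈ ℤ^d` with `M_β ≠ 0` such that for all `γ ∈ β + Q` the inclusion
`M_γ ↪ E(M)_γ` into the `ℤ^d`-graded injective hull is an isomorphism.  Here the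
injective hull is presented as a degree-preserving embedding `ι` of `M` into a
finite direct sum `⊕_j k{α_j + E_{F_j}}` of indecomposable `ℤ^d`-graded injectives
which is graded-essential. -/
theorem degrees_where_module_equals_hull
    (hQ : IsNormalAffineSemigroup Q)
    (M : Type) [AddCommGroup M] [Module (kQ k Q) M] [Module k M]
    [IsScalarTower k (kQ k Q) M]
    (degM : L d → Submodule k M)
    (hint : DirectSum.IsInternal degM)
    (hcompat : ∀ (q : Q) (a : L d) (m : M), m ∈ degM a →
      mono k Q q • m ∈ degM ((q : L d) + a))
    (hfg : Module.Finite (kQ k Q) M)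
    (hnz : ∃ m : M, m ≠ 0)
    (n : ℕ) (α : Fin n → L d) (F : Fin n → AddSubmonoid (L d))
    (hF : ∀ j, IsFace Q (F j))
    (emb : M →ₗ[kQ k Q] ⨁ j : Fin n, injMod k Q (EFset Q (α j) (F j)))
    (hinj : Function.Injective emb)
    (hdeg : ∀ (a : L d) (m : M), m ∈ degM a →
      emb m ∈ injSumDeg k Q (fun j : Fin n => EFset Q (α j) (F j)) a)
    (hess : ∀ N : Submodule (kQ k Q) (⨁ j : Fin n, injMod k Q (EFset Q (α j) (F j))),
      IsGradedSub k Q (fun j : Fin n => EFset Q (α j) (F j)) N → N ≠ ⊥ →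
        N ⊓ LinearMap.range emb ≠ ⊥) :
    ∃ β : L d, degM β ≠ ⊥ ∧
      ∀ (q : Q) (x : ⨁ j : Fin n, injMod k Q (EFset Q (α j) (F j))),
        x ∈ injSumDeg k Q (fun j : Fin n => EFset Q (α j) (F j)) (β + (q : L d)) →
        ∃ m ∈ degM (β + (q : L d)), emb m = x := by
  set SS : Fin n → Set (L d) := fun j : Fin n => EFset Q (α j) (F j) with hSS
  have hS : ∀ j b (q : Q), b + (q : L d) ∈ SS j → b ∈ SS j :=
    fun j b q h => EFset_down Q _ _ b q h
  have hFQ : ∀ j, ∀ f ∈ F j, f ∈ Q := by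
    intro j f hf
    obtain ⟨lam, _, h⟩ := hF j
    have : f ∈ (F j : Set (L d)) := hf
    rw [h] at this
    exact this.1
  have hface : ∀ j (f g : L d), f ∈ Q → g ∈ Q → f + g ∈ F j → f ∈ F j := by
    intro j f g hf hg hfg
    obtain ⟨lam, h0, h⟩ := hF j
    have h1 : f + g ∈ (F j : Set (L d)) := hfg
    rw [h] at h1
    have h2 : f ∈ (F j : Set (L d)) := by
      rw [h]
      refine ⟨hf, ?_⟩
      have := h0 f hf
      have := h0 g hg
      have h3 := h1.2
      rw [map_add] at h3
      omega
    exact h2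
  have hne : Nonempty (Fin n) := by
    by_contra hemp
    rw [not_nonempty_iff] at hemp
    obtain ⟨m, hm⟩ := hnz
    apply hm
    apply hinj
    apply DFinsupp.ext
    intro i
    exact hemp.elim i
  obtain ⟨i0, hi0⟩ : ∃ i0, ∀ j, SS i0 ⊆ SS j → SS j = SS i0 := by
    obtain ⟨T, ⟨i0, rfl⟩, hT⟩ := (Set.finite_range SS).exists_maximal (Set.range_nonempty SS)
    exact ⟨i0, fun j h => Set.Subset.antisymm (hT ⟨j, rfl⟩ h) h⟩
  have hinS : ∀ f ∈ F i0, α i0 + f ∈ SS i0 := fun f hf => ⟨f, hf, 0, Q.zero_mem, by simp⟩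
  -- the good condition
  have hgood : ∀ j, ∃ f ∈ F i0, ∀ q ∈ Q, α i0 + f + q ∈ SS j →
      ∃ m ∈ degM (α i0 + f + q), emb m = eb k Q SS j (α i0 + f + q) := by
    intro j
    by_cases hj : SS i0 ⊆ SS j
    · have hj' := hi0 j hj
      obtain ⟨q, hq, m, hm, hme⟩ := ess_step k Q SS hS M degM hint emb hdeg hess j (α i0 + 0)
        (hj (hinS 0 (F i0).zero_mem))
      rw [add_zero] at hq hm hme
      have hmem : ∀ g ∈ Q, α i0 + g ∈ SS j → g ∈ F i0 := by
        intro g hg h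
        rw [hj'] at h
        obtain ⟨f', hf', a, ha, h⟩ := h
        apply hface i0 g a hg ha
        have : g + a = f' := by
          have h2 : g = f' - a := by
            apply add_left_cancel (a := α i0)
            rw [h]; abel
          rw [h2]; abel
        rw [this]; exact hf'
      refine ⟨q, hmem q q.2 hq, ?_⟩
      intro p hp _
      refine ⟨mono k Q ⟨p, hp⟩ • m, ?_, ?_⟩
      · have := hcompat ⟨p, hp⟩ _ m hm
        rwa [add_comm] at this
      · rw [map_smul, hme, mono_smul_eb k Q SS hS]
    · have : ∃ f ∈ F i0, α i0 + f ∉ SS j := by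
        by_contra! hcon
        apply hj
        rintro b ⟨f, hf, a, ha, rfl⟩
        apply hS j _ ⟨a, ha⟩
        simpa using hcon f hf
      obtain ⟨f, hf, hfn⟩ := this
      exact ⟨f, hf, fun q hq h => absurd (hS j _ ⟨q, hq⟩ h) hfn⟩
  choose f hf hfg using hgood
  have hsum : ∑ j, f j ∈ F i0 := sum_mem (fun j _ => hf j)
  have hall : ∀ j, ∀ q ∈ Q, α i0 + ∑ j, f j + q ∈ SS j →
      ∃ m ∈ degM (α i0 + ∑ j, f j + q), emb m = eb k Q SS j (α i0 + ∑ j, f j + q) := by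
    intro j q hq h
    have e : α i0 + ∑ j, f j + q = α i0 + f j + ((∑ i ∈ Finset.univ.erase j, f i) + q) := by
      rw [← Finset.add_sum_erase _ _ (Finset.mem_univ j)]; abel
    rw [e] at h ⊢
    exact hfg j _ (Q.add_mem (sum_mem fun i _ => hFQ _ _ (hf i)) hq) h
  refine ⟨α i0 + ∑ j, f j, ?_, ?_⟩
  · intro hbot
    obtain ⟨m, hm, hme⟩ := hall i0 0 Q.zero_mem (by rw [add_zero]; exact hinS _ hsum)
    rw [add_zero] at hm hme
    rw [hbot, Submodule.mem_bot] at hm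
    rw [hm, map_zero] at hme
    exact eb_ne_zero k Q SS hS i0 _ (hinS _ hsum) hme.symm
  · intro q x hx
    rw [injSumDeg_eq] at hx
    induction hx using Submodule.span_induction with
    | mem x hx =>
      obtain ⟨j, rfl⟩ := hx
      by_cases h : α i0 + ∑ j, f j + (q : L d) ∈ SS j
      · exact hall j q q.2 h
      · exact ⟨0, Submodule.zero_mem _, (map_zero emb).trans (eb_neg k Q SS j _ h).symm⟩
    | zero => exact ⟨0, Submodule.zero_mem _, map_zero _⟩
    | add x y _ _ hx hy =>
      obtain ⟨m, hm, rfl⟩ := hx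
      obtain ⟨m', hm', rfl⟩ := hy
      exact ⟨m + m', Submodule.add_mem _ hm hm', map_add _ _ _⟩
    | smul c x _ hx =>
      obtain ⟨m, hm, rfl⟩ := hx
      exact ⟨c • m, Submodule.smul_mem _ _ hm, LinearMap.map_smul_of_tower _ _ _⟩


end ZMS
end
end

section
/- The total complex tot D(Δ), with tot^m D(Δ) = ⊕_{p+q=m} D(Δ)_{pq}, total differential δ + ∂, and augmentation k[Q]/I_Δ → tot⁰ D(Δ) induced by 1 ↦ Σ_{F∈Δ} ε_F (F ⊗ e_F) where ε_F = (−1)^{dim F (dim F + 1)/2}, is an irreducible resolution of k[Q]/I_Δ: the augmented complex 0 → k[Q]/I_Δ → tot⁰ D(Δ) → tot¹ D(Δ) → ⋯ is exact, and each term is a direct sum of quotients of k[Q] by irreducible monomial ideals. -/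
attribute [local instance] Classical.propDecidable

set_option synthInstance.maxHeartbeats 1000000
set_option maxHeartbeats 4000000

noncomputable section

open DirectSum

namespace ZMS

variable (k : Type) [Field k] {d : ℕ} (Q : AddSubmonoid (L d))

section Zeeman

variable (Δ : Finset (AddSubmonoid (L d)))
variable (ε : AddSubmonoid (L d) → AddSubmonoid (L d) → ℤ)
/-- `Δ` is a polyhedral subcomplex of `ℝ_{≥0} Q`: a collection of faces of `Q`
closed under taking faces. -/
def IsPolyhedralComplex : Prop :=
  (∀ F ∈ Δ, IsFace Q F) ∧ (∀ F ∈ Δ, ∀ G, IsFace Q G → G ≤ F → G ∈ Δ)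

/-- `ε` is an incidence function on the faces of `ℝ_{≥0} Q`. -/
def IsIncidence : Prop :=
  (∀ G' G, IsFacetOf Q G' G → ε G' G = 1 ∨ ε G' G = -1) ∧
  (∀ G₁ G₂ G₃ G₄, G₂ ≠ G₃ → IsFacetOf Q G₁ G₂ → IsFacetOf Q G₂ G₄ →
    IsFacetOf Q G₁ G₃ → IsFacetOf Q G₃ G₄ →
    ε G₁ G₂ * ε G₂ G₄ + ε G₁ G₃ * ε G₃ G₄ = 0)

/-- The dimension of the polyhedral complex `Δ`. -/
abbrev cxDim : ℕ := Δ.sup faceDim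

/-- The radical monomial ideal `I_Δ`, spanned by all monomials lying on no face of `Δ`. -/
def complexIdeal : Ideal (kQ k Q) :=
  Ideal.span {m | ∃ q : Q, (∀ F ∈ Δ, (q : L d) ∉ F) ∧ m = mono k Q q}


end Zeeman

section Zeeman

variable (Δ : Finset (AddSubmonoid (L d)))
variable (ε : AddSubmonoid (L d) → AddSubmonoid (L d) → ℤ)
/-- Pairs `(F, G)` of faces of `Δ` with `F ⊇ G`, indexing the generators
`F ⊗ e_G` of the Zeeman double complex. -/
abbrev ZP : Type :=
  {x : {F // F ∈ Δ} × {F // F ∈ Δ} // (x.2 : AddSubmonoid (L d)) ≤ (x.1 : AddSubmonoid (L d))}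

/-- First component (the face `F`). -/
def ZP.Fc (x : ZP Δ) : AddSubmonoid (L d) := x.1.1

/-- Second component (the face `G`). -/
def ZP.Gc (x : ZP Δ) : AddSubmonoid (L d) := x.1.2

/-- Indices of bidegree `(p, -q)` (recorded as `dim F = p`, `dim G = q`). -/
abbrev DIdx (p q : ℕ) : Type :=
  {x : ZP Δ // faceDim (ZP.Fc Δ x) = p ∧ faceDim (ZP.Gc Δ x) = q}

/-- The Zeeman double complex `D(Δ)` in bidegree `(p,-q)`: the direct sum of
`kF ⊗_k k[G] ≅ k[G]` over faces `F ⊇ G` in `Δ` with `dim F = p`, `dim G = q`. -/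
abbrev DMod (p q : ℕ) : Type :=
  ⨁ x : DIdx Δ p q, kQ k Q ⧸ facePrime k Q (ZP.Gc Δ x.1)


end Zeeman

section Zeeman

variable (Δ : Finset (AddSubmonoid (L d)))
variable (ε : AddSubmonoid (L d) → AddSubmonoid (L d) → ℤ)
/-- Indices of total (cohomological) degree `m`, i.e. `dim F - dim G = m`. -/
abbrev TIdx (m : ℕ) : Type :=
  {x : ZP Δ // faceDim (ZP.Fc Δ x) = faceDim (ZP.Gc Δ x) + m}

/-- The total complex `tot D(Δ)` in cohomological degree `m`. -/
abbrev TMod (m : ℕ) : Type :=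
  ⨁ x : TIdx Δ m, kQ k Q ⧸ facePrime k Q (ZP.Gc Δ x.1)

/-- The total differential `δ + ∂` on `tot D(Δ)`. -/
def tdiff (m : ℕ) : TMod k Q Δ m →ₗ[kQ k Q] TMod k Q Δ (m+1) :=
  DirectSum.toModule _ _ _ fun x =>
    (∑ y : TIdx Δ (m+1),
      if h : ZP.Gc Δ y.1 = ZP.Gc Δ x.1 ∧ IsFacetOf Q (ZP.Fc Δ x.1) (ZP.Fc Δ y.1)
      then ((-1 : ℤ) ^ faceDim (ZP.Gc Δ x.1) * ε (ZP.Fc Δ x.1) (ZP.Fc Δ y.1)) •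
        ((DirectSum.lof (kQ k Q) _ _ y) ∘ₗ
          fMap k Q (le_of_eq (show facePrime k Q (ZP.Gc Δ x.1) = facePrime k Q (ZP.Gc Δ y.1)
            by rw [h.1])))
      else 0) +
    (∑ y : TIdx Δ (m+1),
      if h : ZP.Fc Δ y.1 = ZP.Fc Δ x.1 ∧ IsFacetOf Q (ZP.Gc Δ y.1) (ZP.Gc Δ x.1)
      then (ε (ZP.Gc Δ y.1) (ZP.Gc Δ x.1)) •
        ((DirectSum.lof (kQ k Q) _ _ y) ∘ₗ fMap k Q (facePrime_mono k Q h.2.2.2.1))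
      else 0)

/-- The augmentation `k[Q] → tot⁰ D(Δ)`, `1 ↦ Σ_F ε_F (F ⊗ e_F)` with
`ε_F = (-1)^{dim F (dim F + 1)/2}`. -/
def totAug : kQ k Q →ₗ[kQ k Q] TMod k Q Δ 0 :=
  ∑ x : TIdx Δ 0,
    if ZP.Fc Δ x.1 = ZP.Gc Δ x.1
    then ((-1 : ℤ) ^ (faceDim (ZP.Fc Δ x.1) * (faceDim (ZP.Fc Δ x.1) + 1) / 2)) •
      ((DirectSum.lof (kQ k Q) _ _ x) ∘ₗ (facePrime k Q (ZP.Gc Δ x.1)).mkQ)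
    else 0


end Zeeman



/-! ### Abstract acyclicity -/

/-- The finite based complex with index set `S` and matrix `t` is acyclic. -/
def Acyc {K α : Type} [Field K] (t : α → α → K) (S : Finset α) : Prop :=
  ∀ c : α → K, (∀ y ∈ S, ∑ x ∈ S, c x * t x y = 0) →
    ∃ b : α → K, ∀ y ∈ S, ∑ x ∈ S, b x * t x y = c y

lemma Acyc.union {K α : Type} [Field K] {t : α → α → K} {U V : Finset α}
    (hd : Disjoint U V) (hU : Acyc t U) (hV : Acyc t V)
    (h0 : ∀ x ∈ V, ∀ y ∈ U, t x y = 0)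
    (sq : ∀ x ∈ U ∪ V, ∀ z ∈ U ∪ V, ∑ y ∈ U ∪ V, t x y * t y z = 0) : Acyc t (U ∪ V) := by
  intro c hc
  have key : ∀ (c : α → K), ∀ y ∈ U, ∑ x ∈ U ∪ V, c x * t x y = ∑ x ∈ U, c x * t x y := by
    intro c y hy
    rw [Finset.sum_union hd]
    have : ∑ x ∈ V, c x * t x y = 0 :=
      Finset.sum_eq_zero fun x hx => by rw [h0 x hx y hy, mul_zero]
    rw [this, add_zero]
  obtain ⟨b2, hb2⟩ := hU c (fun y hy => by
    rw [← key c y hy]; exact hc y (Finset.mem_union_left _ hy))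
  have hc' : ∀ y ∈ V, ∑ x ∈ V, (c x - ∑ w ∈ U, b2 w * t w x) * t x y = 0 := by
    intro y hy
    have h1 : ∑ x ∈ U ∪ V, (c x - ∑ w ∈ U, b2 w * t w x) * t x y
        = ∑ x ∈ V, (c x - ∑ w ∈ U, b2 w * t w x) * t x y := by
      rw [Finset.sum_union hd]
      have : ∑ x ∈ U, (c x - ∑ w ∈ U, b2 w * t w x) * t x y = 0 :=
        Finset.sum_eq_zero fun x hx => by rw [hb2 x hx, sub_self, zero_mul]
      rw [this, zero_add]
    rw [← h1]
    simp only [sub_mul, Finset.sum_sub_distrib, Finset.sum_mul]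
    rw [hc y (Finset.mem_union_right _ hy), Finset.sum_comm, zero_sub, neg_eq_zero]
    refine Finset.sum_eq_zero fun w hw => ?_
    have := sq w (Finset.mem_union_left _ hw) y (Finset.mem_union_right _ hy)
    simp only [mul_assoc, ← Finset.mul_sum]
    rw [this, mul_zero]
  obtain ⟨b1, hb1⟩ := hV _ hc'
  have hnot : ∀ x ∈ V, x ∉ U := fun x hx hx' => Finset.disjoint_left.1 hd hx' hx
  refine ⟨fun x => if x ∈ U then b2 x else b1 x, fun y hy => ?_⟩
  have e1 : ∑ x ∈ U, (if x ∈ U then b2 x else b1 x) * t x y = ∑ x ∈ U, b2 x * t x y :=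
    Finset.sum_congr rfl fun x hx => by rw [if_pos hx]
  have e2 : ∑ x ∈ V, (if x ∈ U then b2 x else b1 x) * t x y = ∑ x ∈ V, b1 x * t x y :=
    Finset.sum_congr rfl fun x hx => by rw [if_neg (hnot x hx)]
  by_cases hyU : y ∈ U
  · rw [key _ y hyU, e1, hb2 y hyU]
  · have hyV : y ∈ V := by
      rcases Finset.mem_union.1 hy with h | h
      · exact absurd h hyU
      · exact h
    rw [Finset.sum_union hd, e1, e2, hb1 y hyV]
    ring

lemma Acyc.of_fibres {K α β : Type} [Field K] [PartialOrder β] {t : α → α → K} (h : α → β)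
    (n : ℕ) : ∀ (S : Finset α), S.card = n →
    (∀ x ∈ S, ∀ y ∈ S, t x y ≠ 0 → h x ≤ h y) →
    (∀ x ∈ S, ∀ z ∈ S, ∑ y ∈ S, t x y * t y z = 0) →
    (∀ x0 ∈ S, ∀ T : Finset α, (∀ x, x ∈ T ↔ x ∈ S ∧ h x = h x0) → Acyc t T) →
    Acyc t S := by
  induction n using Nat.strong_induction_on with
  | _ n ih =>
    intro S hn hm sq hf
    rcases S.eq_empty_or_nonempty with rfl | hne
    · intro c _; exact ⟨0, by simp⟩
    obtain ⟨p, hp⟩ := (S.image h).exists_minimal (hne.image h)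
    have hS : S = (S.filter fun x => h x = p) ∪ (S.filter fun x => ¬ h x = p) :=
      (Finset.filter_union_filter_not_eq _ S).symm
    have hmin : ∀ x ∈ S, h x ≤ p → h x = p := fun x hx hxp =>
      le_antisymm hxp (hp.2 (Finset.mem_image_of_mem h hx) hxp)
    obtain ⟨x0, hx0, hx0p⟩ := Finset.mem_image.1 hp.1
    have h0 : ∀ x ∈ (S.filter fun x => ¬ h x = p), ∀ y ∈ S, h y = p → t x y = 0 := by
      intro x hx y hy hyp
      rw [Finset.mem_filter] at hx
      by_contra hne
      exact hx.2 (hmin x hx.1 (hyp ▸ hm x hx.1 y hy hne))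
    rw [hS]
    apply Acyc.union (Finset.disjoint_filter_filter_not _ _ _)
      (hf x0 hx0 _ fun x => by rw [Finset.mem_filter, hx0p])
    · refine ih _ ?_ _ rfl ?_ ?_ ?_
      · rw [← hn]
        exact Finset.card_lt_card (Finset.filter_ssubset.2 ⟨x0, hx0, by simpa using hx0p⟩)
      · intro x hx y hy
        exact hm x (Finset.mem_filter.1 hx).1 y (Finset.mem_filter.1 hy).1
      · intro x hx z hz
        rw [Finset.sum_filter]
        refine Eq.trans ?_ (sq x (Finset.mem_filter.1 hx).1 z (Finset.mem_filter.1 hz).1)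
        refine Finset.sum_congr rfl fun y hy => ?_
        split_ifs with hyp
        · rw [h0 x hx y hy hyp, zero_mul]
        · rfl
      · intro x hx T hT
        rw [Finset.mem_filter] at hx
        refine hf x hx.1 T fun y => ?_
        rw [hT, Finset.mem_filter]
        constructor
        · rintro ⟨⟨h1, h2⟩, h3⟩; exact ⟨h1, h3⟩
        · rintro ⟨h1, h3⟩; exact ⟨⟨h1, by rw [h3]; exact hx.2⟩, h3⟩
    · intro x hx y hy
      rw [Finset.mem_filter] at hy
      exact h0 x hx y hy.1 hy.2
    · rw [← hS]; exact sq

lemma Acyc.pair {K α : Type} [Field K] {t : α → α → K} {x y : α} (hxy : x ≠ y)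
    (h1 : t x y ≠ 0) (h2 : t x x = 0) (h3 : t y y = 0) (h4 : t y x = 0) : Acyc t {x, y} := by
  intro c hc
  have hcy := hc y (by simp)
  rw [Finset.sum_pair hxy, h3, mul_zero, add_zero] at hcy
  have hcx : c x = 0 := by
    rcases mul_eq_zero.1 hcy with h | h
    · exact h
    · exact absurd h h1
  refine ⟨fun _ => c y / t x y, fun z hz => ?_⟩
  rw [Finset.sum_pair hxy]
  rcases Finset.mem_insert.1 hz with rfl | hz
  · rw [h2, h4, hcx]; ring
  · rw [Finset.mem_singleton] at hz
    subst hz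
    rw [h3]; field_simp; ring

lemma Acyc.map {K α β : Type} [Field K] {t : α → α → K} {t' : β → β → K} {S : Finset α}
    (f : α → β) (hf : Function.Injective f) (ht : ∀ x ∈ S, ∀ y ∈ S, t' (f x) (f y) = t x y)
    (hS : Acyc t S) : Acyc t' (S.image f) := by
  intro c hc
  have hs : ∀ (c : β → K), ∀ y ∈ S, ∑ x ∈ S.image f, c x * t' x (f y)
      = ∑ x ∈ S, c (f x) * t x y := by
    intro c y hy
    rw [Finset.sum_image (fun a _ b _ hab => hf hab)]
    exact Finset.sum_congr rfl fun x hx => by rw [ht x hx y hy]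
  obtain ⟨b, hb⟩ := hS (fun x => c (f x)) (fun y hy => by
    rw [← hs c y hy]; exact hc _ (Finset.mem_image_of_mem f hy))
  refine ⟨fun z => if h : ∃ x, f x = z then b h.choose else 0, fun z hz => ?_⟩
  obtain ⟨y, hy, rfl⟩ := Finset.mem_image.1 hz
  rw [hs _ y hy, ← hb y hy]
  refine Finset.sum_congr rfl fun x _ => ?_
  have hex : ∃ x', f x' = f x := ⟨x, rfl⟩
  rw [dif_pos hex, hf hex.choose_spec]

/-! ### Polyhedral description of a finitely generated cone (Fourier–Motzkin) -/

lemma exists_functionals {d : ℕ} (B : Finset (L d)) :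
    ∃ M : Finset (L d →ₗ[ℤ] ℤ), ∀ x : L d, (∀ μ ∈ M, 0 ≤ μ x) ↔
      ∃ n : ℕ, 0 < n ∧ n • x ∈ AddSubmonoid.closure (B : Set (L d)) := by
  induction B using Finset.induction_on with
  | empty =>
    refine ⟨(Finset.univ.image fun i : Fin d => LinearMap.proj i) ∪
      (Finset.univ.image fun i : Fin d => -LinearMap.proj i), fun x => ?_⟩
    constructor
    · intro h
      refine ⟨1, one_pos, ?_⟩
      have : x = 0 := by
        funext i
        have h1 := h (LinearMap.proj i) (by simp)
        have h2 := h (-LinearMap.proj i) (by simp)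
        simp at h1 h2
        simp; omega
      simp [this]
    · rintro ⟨n, hn, hx⟩
      rw [Finset.coe_empty, AddSubmonoid.closure_empty, AddSubmonoid.mem_bot] at hx
      have : x = 0 := by
        rcases smul_eq_zero.1 hx with h | h
        · omega
        · exact h
      simp [this]
  | insert b B hb ih =>
    obtain ⟨M, hM⟩ := ih
    refine ⟨M.filter (fun μ => 0 ≤ μ b) ∪
      ((M.filter (fun μ => 0 < μ b)) ×ˢ (M.filter (fun μ => μ b < 0))).image
        (fun p => (-(p.2 b)) • p.1 + (p.1 b) • p.2), fun x => ?_⟩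
    have hcl : ∀ y : L d, y ∈ AddSubmonoid.closure ((insert b B : Finset (L d)) : Set (L d)) ↔
        ∃ c ∈ AddSubmonoid.closure (B : Set (L d)), ∃ m : ℕ, y = c + m • b := by
      intro y
      rw [Finset.coe_insert, Set.insert_eq, AddSubmonoid.closure_union, sup_comm,
        AddSubmonoid.mem_sup]
      constructor
      · rintro ⟨c, hc, z, hz, rfl⟩
        obtain ⟨m, rfl⟩ := AddSubmonoid.mem_closure_singleton.1 hz
        exact ⟨c, hc, m, rfl⟩
      · rintro ⟨c, hc, m, rfl⟩
        exact ⟨c, hc, m • b, AddSubmonoid.mem_closure_singleton.2 ⟨m, rfl⟩, rfl⟩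
    constructor
    · intro h
      have h1 : ∀ μ ∈ M, 0 ≤ μ b → 0 ≤ μ x := fun μ hμ hb => h μ (by
        rw [Finset.mem_union]; left; simp [hμ, hb])
      have h2 : ∀ μ ∈ M, ∀ ν ∈ M, 0 < μ b → ν b < 0 → 0 ≤ -(ν b) * μ x + μ b * ν x := by
        intro μ hμ ν hν hb1 hb2
        have := h ((-(ν b)) • μ + (μ b) • ν) (by
          rw [Finset.mem_union]; right
          rw [Finset.mem_image]
          exact ⟨(μ, ν), by simp [hμ, hν, hb1, hb2], rfl⟩)
        simpa using this
      have h3 : ∃ (r : ℕ) (p : ℕ), 0 < r ∧ ∀ μ ∈ M, 0 ≤ (r : ℤ) * μ x - p * μ b := by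
        by_cases hN : (M.filter fun ν => ν b < 0 ∧ ν x < 0).Nonempty
        · obtain ⟨ν0, hν0, hmax⟩ := Finset.exists_max_image _
            (fun ν : L d →ₗ[ℤ] ℤ => (ν x : ℚ) / (ν b : ℚ)) hN
          rw [Finset.mem_filter] at hν0
          obtain ⟨hν0M, hνb, hνx⟩ := hν0
          refine ⟨(-(ν0 b)).toNat, (-(ν0 x)).toNat, by omega, fun μ hμ => ?_⟩
          rw [Int.toNat_of_nonneg (by omega), Int.toNat_of_nonneg (by omega)]
          rcases lt_trichotomy (μ b) 0 with hμb | hμb | hμb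
          · by_cases hμx : μ x < 0
            · have := hmax μ (by simp [hμ, hμb, hμx])
              have a1 : (μ b : ℚ) < 0 := by exact_mod_cast hμb
              have a2 : (ν0 b : ℚ) < 0 := by exact_mod_cast hνb
              have h4 : (μ x : ℚ) * (ν0 b : ℚ) ≤ ν0 x * μ b := by
                have h5 := mul_le_mul_of_nonneg_right this (mul_pos_of_neg_of_neg a1 a2).le
                have e1 : (μ x : ℚ) / μ b * (μ b * ν0 b) = μ x * ν0 b := by
                  have := a1.ne
                  field_simp
                have e2 : (ν0 x : ℚ) / ν0 b * (μ b * ν0 b) = ν0 x * μ b := by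
                  have := a2.ne
                  field_simp
                rwa [e1, e2] at h5
              have h6 : μ x * ν0 b ≤ ν0 x * μ b := by exact_mod_cast h4
              linarith
            · have := mul_nonneg (a := -(ν0 b)) (b := μ x) (by omega) (by omega)
              have := mul_pos_of_neg_of_neg hνx hμb
              linarith
          · have := h1 μ hμ hμb.ge
            rw [hμb]
            have := mul_nonneg (a := -(ν0 b)) (b := μ x) (by omega) (by omega)
            linarith
          · have := h2 μ hμ ν0 hν0M hμb hνb
            linarith
        · refine ⟨1, 0, one_pos, fun μ hμ => ?_⟩
          rw [Finset.not_nonempty_iff_eq_empty, Finset.filter_eq_empty_iff] at hN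
          have := hN hμ
          have := h1 μ hμ
          simp
          by_contra hcon
          omega
      obtain ⟨r, p, hr, hrp⟩ := h3
      obtain ⟨n, hn, hmem⟩ := (hM (r • x - p • b)).1 (fun μ hμ => by
        rw [map_sub, map_nsmul, map_nsmul, nsmul_eq_mul, nsmul_eq_mul]
        exact hrp μ hμ)
      refine ⟨n * r, Nat.mul_pos hn hr, (hcl _).2 ⟨_, hmem, n * p, ?_⟩⟩
      rw [smul_sub, mul_smul, mul_smul]; abel
    · rintro ⟨n, hn, hx⟩ μ hμ
      obtain ⟨c, hc, m, hcm⟩ := (hcl _).1 hx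
      have hcpos : ∀ μ ∈ M, 0 ≤ μ c := (hM c).2 ⟨1, one_pos, by simpa using hc⟩
      have hE : ∀ μ : L d →ₗ[ℤ] ℤ, (n : ℤ) * μ x = μ c + m * μ b := by
        intro μ
        have := congrArg μ hcm
        rwa [map_add, map_nsmul, map_nsmul, nsmul_eq_mul, nsmul_eq_mul] at this
      have hn' : (0 : ℤ) < n := by exact_mod_cast hn
      have hm' : (0 : ℤ) ≤ m := by positivity
      suffices hs : 0 ≤ (n : ℤ) * μ x from nonneg_of_mul_nonneg_right hs hn'
      rw [hE]
      rcases Finset.mem_union.1 hμ with h | h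
      · rw [Finset.mem_filter] at h
        have := hcpos μ h.1
        have := mul_nonneg hm' h.2
        omega
      · obtain ⟨⟨μ1, ν1⟩, hp, rfl⟩ := Finset.mem_image.1 h
        simp only [Finset.mem_product, Finset.mem_filter] at hp
        have a1 := mul_nonneg (a := -(ν1 b)) (by omega) (hcpos μ1 hp.1.1)
        have a2 := mul_nonneg hp.1.2.le (hcpos ν1 hp.2.1)
        have e : (-(ν1 b) * μ1 b + μ1 b * ν1 b) = 0 := by ring
        simp only [LinearMap.add_apply, LinearMap.smul_apply, smul_eq_mul]
        rw [e]; linarith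

/-! ### Faces via a polyhedral description -/

/-- `μ` vanishes on `F`. -/
def Van {d : ℕ} (μ : L d →ₗ[ℤ] ℤ) (F : AddSubmonoid (L d)) : Prop := ∀ x ∈ F, μ x = 0

/-- `M` is a finite list of inequalities describing `Q`. -/
def Desc {d : ℕ} (Q : AddSubmonoid (L d)) (M : Finset (L d →ₗ[ℤ] ℤ)) : Prop :=
  ∀ x : L d, x ∈ Q ↔ ∀ μ ∈ M, 0 ≤ μ x

/-- The part of `P` on which `μ` vanishes. -/
def cutF {d : ℕ} (P : AddSubmonoid (L d)) (μ : L d →ₗ[ℤ] ℤ) : AddSubmonoid (L d) :=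
  P ⊓ AddMonoidHom.mker μ.toAddMonoidHom

lemma mem_cutF {d : ℕ} {P : AddSubmonoid (L d)} {μ : L d →ₗ[ℤ] ℤ} {x : L d} :
    x ∈ cutF P μ ↔ x ∈ P ∧ μ x = 0 := by
  rw [cutF, AddSubmonoid.mem_inf, AddMonoidHom.mem_mker]; rfl

section
variable {d : ℕ} {Q : AddSubmonoid (L d)} {M : Finset (L d →ₗ[ℤ] ℤ)}

lemma exists_desc (hQ : IsNormalAffineSemigroup Q) : ∃ M, Desc Q M := by
  obtain ⟨B, hB⟩ := hQ.fg
  obtain ⟨M, hM⟩ := exists_functionals B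
  refine ⟨M, fun x => ?_⟩
  rw [hM, hB]
  constructor
  · intro h; exact ⟨1, one_pos, by simpa using h⟩
  · rintro ⟨n, hn, h⟩; exact hQ.saturated x n hn h

lemma IsFace.le {F : AddSubmonoid (L d)} (hF : IsFace Q F) : F ≤ Q := by
  obtain ⟨lam, _, h⟩ := hF
  intro x hx
  have : x ∈ (F : Set (L d)) := hx
  rw [h] at this
  exact this.1

lemma IsFace.exists_lam {F : AddSubmonoid (L d)} (hF : IsFace Q F) :
    ∃ lam : L d →ₗ[ℤ] ℤ, (∀ x ∈ Q, 0 ≤ lam x) ∧ ∀ x, x ∈ F ↔ x ∈ Q ∧ lam x = 0 := by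
  obtain ⟨lam, h0, h⟩ := hF
  refine ⟨lam, h0, fun x => ?_⟩
  rw [← SetLike.mem_coe, h]; rfl

lemma IsFace.mk' {F : AddSubmonoid (L d)} (lam : L d →ₗ[ℤ] ℤ) (h0 : ∀ x ∈ Q, 0 ≤ lam x)
    (h : ∀ x, x ∈ F ↔ x ∈ Q ∧ lam x = 0) : IsFace Q F :=
  ⟨lam, h0, by ext x; exact h x⟩

lemma Desc.pos (hM : Desc Q M) {μ : L d →ₗ[ℤ] ℤ} (hμ : μ ∈ M) {x : L d} (hx : x ∈ Q) :
    0 ≤ μ x := (hM x).1 hx μ hμ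

lemma Desc.bump (hM : Desc Q M) {q x : L d} (hq : q ∈ Q)
    (h : ∀ μ ∈ M, μ q = 0 → 0 ≤ μ x) : ∃ N : ℕ, N • q + x ∈ Q := by
  refine ⟨∑ μ ∈ M, (μ x).natAbs, (hM _).2 fun μ hμ => ?_⟩
  rw [map_add, map_nsmul, nsmul_eq_mul]
  have hle : (μ x).natAbs ≤ ∑ μ ∈ M, (μ x).natAbs :=
    Finset.single_le_sum (f := fun μ : L d →ₗ[ℤ] ℤ => (μ x).natAbs)
      (fun _ _ => Nat.zero_le _) hμ
  rcases (hM.pos hμ hq).eq_or_lt with h0 | h0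
  · rw [← h0, mul_zero, zero_add]; exact h μ hμ h0.symm
  · have : ((∑ μ ∈ M, (μ x).natAbs : ℕ) : ℤ) * 1 ≤ ((∑ μ ∈ M, (μ x).natAbs : ℕ) : ℤ) * μ q :=
      mul_le_mul_of_nonneg_left h0 (by positivity)
    omega

lemma Desc.mem_of (hM : Desc Q M) {F : AddSubmonoid (L d)} (hF : IsFace Q F) {f x : L d}
    (hf : f ∈ F) (hx : x ∈ Q) (h : ∀ μ ∈ M, μ f = 0 → μ x = 0) : x ∈ F := by
  obtain ⟨lam, h0, hl⟩ := hF.exists_lam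
  obtain ⟨N, hN⟩ := hM.bump (x := -x) (hF.le hf) (fun μ hμ h1 => by
    rw [map_neg, h μ hμ h1, neg_zero])
  have h1 := h0 _ hN
  rw [map_add, map_nsmul, ((hl f).1 hf).2, map_neg, smul_zero, zero_add] at h1
  have h2 := h0 x hx
  exact (hl x).2 ⟨hx, by omega⟩

lemma Desc.relpt (hM : Desc Q M) {F : AddSubmonoid (L d)} (hF : IsFace Q F) :
    ∃ f ∈ F, ∀ μ ∈ M, μ f = 0 → Van μ F := by
  have hch : ∀ μ : L d →ₗ[ℤ] ℤ, ∃ f ∈ F, ¬ Van μ F → μ f ≠ 0 := by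
    intro μ
    by_cases h : Van μ F
    · exact ⟨0, F.zero_mem, fun h' => absurd h h'⟩
    · unfold Van at h
      push Not at h
      obtain ⟨x, hx, hx0⟩ := h
      exact ⟨x, hx, fun _ => hx0⟩
  choose f hf hf' using hch
  refine ⟨∑ μ ∈ M, f μ, AddSubmonoid.sum_mem _ fun μ _ => hf μ, fun μ hμ h0 => ?_⟩
  by_contra hv
  rw [map_sum, Finset.sum_eq_zero_iff_of_nonneg
    (fun ν _ => hM.pos hμ (hF.le (hf ν)))] at h0
  exact hf' μ hv (h0 μ hμ)

lemma Desc.face_mem_iff (hM : Desc Q M) {F : AddSubmonoid (L d)} (hF : IsFace Q F) {x : L d} :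
    x ∈ F ↔ x ∈ Q ∧ ∀ μ ∈ M, Van μ F → μ x = 0 := by
  constructor
  · intro hx; exact ⟨hF.le hx, fun μ _ hv => hv x hx⟩
  · rintro ⟨hx, h⟩
    obtain ⟨f, hf, hfv⟩ := hM.relpt hF
    exact hM.mem_of hF hf hx fun μ hμ h0 => h μ hμ (hfv μ hμ h0)

lemma Desc.face_le (hM : Desc Q M) {F G : AddSubmonoid (L d)} (hF : IsFace Q F)
    (hG : IsFace Q G) (h : ∀ μ ∈ M, Van μ G → Van μ F) : F ≤ G := by
  intro x hx
  exact (hM.face_mem_iff hG).2 ⟨hF.le hx, fun μ hμ hv => h μ hμ hv x hx⟩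

lemma Van.mono {μ : L d →ₗ[ℤ] ℤ} {F G : AddSubmonoid (L d)} (h : Van μ F) (hGF : G ≤ F) :
    Van μ G := fun x hx => h x (hGF hx)

lemma Desc.cut_face (hM : Desc Q M) {P : AddSubmonoid (L d)} (hP : IsFace Q P)
    {μ : L d →ₗ[ℤ] ℤ} (hμ : μ ∈ M) : IsFace Q (cutF P μ) := by
  obtain ⟨lam, h0, hl⟩ := hP.exists_lam
  refine IsFace.mk' (lam + μ) (fun x hx => ?_) (fun x => ?_)
  · exact add_nonneg (h0 x hx) (hM.pos hμ hx)
  · rw [mem_cutF, hl, LinearMap.add_apply]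
    constructor
    · rintro ⟨⟨h1, h2⟩, h3⟩; exact ⟨h1, by omega⟩
    · rintro ⟨h1, h2⟩
      have a := h0 x h1
      have b := hM.pos hμ h1
      exact ⟨⟨h1, by omega⟩, by omega⟩

lemma cutF_le (P : AddSubmonoid (L d)) (μ : L d →ₗ[ℤ] ℤ) : cutF P μ ≤ P :=
  fun _ hx => (mem_cutF.1 hx).1

lemma Desc.min_face (hM : Desc Q M) {q : L d} (hq : q ∈ Q) :
    ∃ A, IsFace Q A ∧ ∀ G, IsFace Q G → (q ∈ G ↔ A ≤ G) := by
  let lam : L d →ₗ[ℤ] ℤ := ∑ μ ∈ M.filter (fun μ => μ q = 0), μ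
  have hlam : ∀ x ∈ Q, lam x = 0 ↔ ∀ μ ∈ M, μ q = 0 → μ x = 0 := by
    intro x hx
    simp only [lam, LinearMap.sum_apply]
    rw [Finset.sum_eq_zero_iff_of_nonneg
      (fun ν hν => hM.pos (Finset.mem_filter.1 hν).1 hx)]
    simp only [Finset.mem_filter, and_imp]
  have hmem : ∀ x, x ∈ cutF Q lam ↔ x ∈ Q ∧ lam x = 0 := fun x => mem_cutF
  refine ⟨cutF Q lam, IsFace.mk' lam ?_ hmem, fun G hG => ⟨fun hqG x hx => ?_, fun h => ?_⟩⟩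
  · intro x hx
    simp only [lam, LinearMap.sum_apply]
    exact Finset.sum_nonneg fun ν hν => hM.pos (Finset.mem_filter.1 hν).1 hx
  · rw [hmem] at hx
    exact hM.mem_of hG hqG hx.1 ((hlam x hx.1).1 hx.2)
  · exact h ((hmem q).2 ⟨hq, (hlam q hq).2 fun μ _ h => h⟩)

lemma Van.closure {μ : L d →ₗ[ℤ] ℤ} {F : AddSubmonoid (L d)} (h : Van μ F) {x : L d}
    (hx : x ∈ AddSubgroup.closure (F : Set (L d))) : μ x = 0 := by
  have : AddSubgroup.closure (F : Set (L d)) ≤ AddMonoidHom.ker μ.toAddMonoidHom := by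
    rw [AddSubgroup.closure_le]
    intro y hy
    exact h y hy
  exact this hx

lemma Desc.closure_mem (hM : Desc Q M) {F : AddSubmonoid (L d)} (hF : IsFace Q F) {x : L d}
    (h : ∀ μ ∈ M, Van μ F → μ x = 0) : x ∈ AddSubgroup.closure (F : Set (L d)) := by
  obtain ⟨f, hf, hfv⟩ := hM.relpt hF
  obtain ⟨N, hN⟩ := hM.bump (x := x) (hF.le hf) (fun μ hμ h0 => (h μ hμ (hfv μ hμ h0)).ge)
  have hmem : N • f + x ∈ F := (hM.face_mem_iff hF).2 ⟨hN, fun μ hμ hv => by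
    rw [map_add, map_nsmul, hv f hf, h μ hμ hv, smul_zero, add_zero]⟩
  have e : x = (N • f + x) - N • f := by abel
  rw [e]
  exact AddSubgroup.sub_mem _ (AddSubgroup.subset_closure hmem)
    (AddSubgroup.nsmul_mem _ (AddSubgroup.subset_closure hf) N)

lemma rank_nullity (V : Submodule ℤ (L d)) (f : V →ₗ[ℤ] ℤ) :
    Module.finrank ℤ (LinearMap.range f) + Module.finrank ℤ (LinearMap.ker f)
      = Module.finrank ℤ V := by
  rw [← Submodule.finrank_quotient_add_finrank (LinearMap.ker f),
    f.quotKerEquivRange.finrank_eq]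

/-- Rank inequality. -/
lemma rank_add_one_le (W V : Submodule ℤ (L d)) (hWV : W ≤ V) (μ : L d →ₗ[ℤ] ℤ)
    (hW : ∀ x ∈ W, μ x = 0) {v : L d} (hv : v ∈ V) (hv0 : μ v ≠ 0) :
    Module.finrank ℤ W + 1 ≤ Module.finrank ℤ V := by
  have h1 := rank_nullity V (μ.domRestrict V)
  have h2 : Module.finrank ℤ W ≤ Module.finrank ℤ (LinearMap.ker (μ.domRestrict V)) := by
    refine LinearMap.finrank_le_finrank_of_injective
      (f := LinearMap.codRestrict _ (Submodule.inclusion hWV) ?_) ?_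
    · intro x
      exact hW x x.2
    · intro x y hxy
      have := congrArg (fun z : LinearMap.ker (μ.domRestrict V) => ((z : V) : L d)) hxy
      exact Subtype.ext this
  have h3 : 1 ≤ Module.finrank ℤ (LinearMap.range (μ.domRestrict V)) := by
    rw [Nat.one_le_iff_ne_zero]
    intro h
    rw [Submodule.finrank_eq_zero] at h
    have : μ.domRestrict V ⟨v, hv⟩ ∈ LinearMap.range (μ.domRestrict V) := ⟨_, rfl⟩
    rw [h, Submodule.mem_bot] at this
    exact hv0 this
  omega

lemma rank_le_add_one (W V : Submodule ℤ (L d)) (μ : L d →ₗ[ℤ] ℤ)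
    (hW : ∀ x ∈ V, μ x = 0 → x ∈ W) :
    Module.finrank ℤ V ≤ Module.finrank ℤ W + 1 := by
  have h1 := rank_nullity V (μ.domRestrict V)
  have h2 : Module.finrank ℤ (LinearMap.ker (μ.domRestrict V)) ≤ Module.finrank ℤ W := by
    refine LinearMap.finrank_le_finrank_of_injective
      (f := LinearMap.codRestrict W (V.subtype ∘ₗ Submodule.subtype _) ?_) ?_
    · intro x
      exact hW x.1 x.1.2 x.2
    · intro x y hxy
      have := congrArg (fun z : W => (z : L d)) hxy
      exact Subtype.ext (Subtype.ext this)
  have h3 : Module.finrank ℤ (LinearMap.range (μ.domRestrict V)) ≤ 1 := by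
    have := Submodule.finrank_le (LinearMap.range (μ.domRestrict V))
    rwa [Module.finrank_self] at this
  omega

/-- The lattice spanned by `F`, as a submodule. -/
def spn (F : AddSubmonoid (L d)) : Submodule ℤ (L d) :=
  AddSubgroup.toIntSubmodule (AddSubgroup.closure (F : Set (L d)))

lemma faceDim_eq (F : AddSubmonoid (L d)) : faceDim F = Module.finrank ℤ (spn F) := rfl

lemma mem_spn {F : AddSubmonoid (L d)} {x : L d} :
    x ∈ spn F ↔ x ∈ AddSubgroup.closure (F : Set (L d)) := Iff.rfl

lemma spn_mono {F G : AddSubmonoid (L d)} (h : F ≤ G) : spn F ≤ spn G :=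
  fun _ hx => AddSubgroup.closure_mono (SetLike.coe_subset_coe.2 h) hx

lemma subset_spn {F : AddSubmonoid (L d)} {x : L d} (hx : x ∈ F) : x ∈ spn F :=
  AddSubgroup.subset_closure hx

lemma faceDim_lt {G F : AddSubmonoid (L d)} (hG : IsFace Q G) (hF : IsFace Q F) (h : G < F) :
    faceDim G < faceDim F := by
  obtain ⟨lam, h0, hl⟩ := hG.exists_lam
  obtain ⟨x, hx, hxG⟩ := SetLike.exists_of_lt h
  rw [faceDim_eq, faceDim_eq]
  refine rank_add_one_le _ _ (spn_mono h.le) lam ?_ (subset_spn hx) ?_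
  · intro y hy
    exact Van.closure (fun z hz => ((hl z).1 hz).2) hy
  · intro h1
    exact hxG ((hl x).2 ⟨hF.le hx, h1⟩)

lemma face_eq_of_dim {G F : AddSubmonoid (L d)} (hG : IsFace Q G) (hF : IsFace Q F) (h : G ≤ F)
    (hd : faceDim F ≤ faceDim G) : G = F := by
  by_contra hne
  have := faceDim_lt hG hF (lt_of_le_of_ne h hne)
  omega

lemma facet_of_ker {H P : AddSubmonoid (L d)} (hH : IsFace Q H) (hP : IsFace Q P)
    (hHP : H < P) (μ : L d →ₗ[ℤ] ℤ) (h : ∀ x ∈ spn P, μ x = 0 → x ∈ spn H) :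
    IsFacetOf Q H P := by
  refine ⟨hH, hP, hHP.le, ?_⟩
  have h1 := faceDim_lt hH hP hHP
  have h2 := rank_le_add_one (spn H) (spn P) μ h
  rw [← faceDim_eq, ← faceDim_eq] at h2
  omega

lemma IsFacetOf.lt {H P : AddSubmonoid (L d)} (h : IsFacetOf Q H P) : H < P := by
  refine lt_of_le_of_ne h.2.2.1 ?_
  rintro rfl
  have := h.2.2.2
  omega

lemma Desc.facet_ker (hM : Desc Q M) {H P : AddSubmonoid (L d)} (hHP : IsFacetOf Q H P)
    {lam : L d →ₗ[ℤ] ℤ} (hv : Van lam H) {p : L d} (hp : p ∈ P) (hp0 : lam p ≠ 0) {x : L d}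
    (hx : x ∈ spn P) (hx0 : lam x = 0) : x ∈ spn H := by
  refine hM.closure_mem hHP.1 fun μ hμ hμv => ?_
  by_contra hne
  have h1 := rank_add_one_le (spn P ⊓ LinearMap.ker lam) (spn P) inf_le_left lam
    (fun y hy => hy.2) (subset_spn hp) hp0
  have h2 := rank_add_one_le (spn H) (spn P ⊓ LinearMap.ker lam)
    (le_inf (spn_mono hHP.2.2.1) (fun y hy => Van.closure hv hy)) μ
    (fun y hy => Van.closure hμv hy) (v := x) ⟨hx, hx0⟩ hne
  have h3 := hHP.2.2.2
  rw [faceDim_eq, faceDim_eq] at h3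
  omega

end

/-! ### The diamond property -/

section
variable {d : ℕ} {Q : AddSubmonoid (L d)} {M : Finset (L d →ₗ[ℤ] ℤ)}

lemma facets_between {A H P : AddSubmonoid (L d)} (hA : IsFace Q A) (hH : IsFace Q H)
    (hP : IsFace Q P) (h1 : A < H) (h2 : H < P) (hd : faceDim A + 2 = faceDim P) :
    IsFacetOf Q A H ∧ IsFacetOf Q H P := by
  have a := faceDim_lt hA hH h1
  have b := faceDim_lt hH hP h2
  exact ⟨⟨hA, hH, h1.le, by omega⟩, ⟨hH, hP, h2.le, by omega⟩⟩

lemma ratio_le {a b c e : ℤ} (hb : 0 < b) (he : 0 < e)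
    (h : (a : ℚ) / b ≤ (c : ℚ) / e) : a * e ≤ c * b := by
  have hb' : (0 : ℚ) < b := by exact_mod_cast hb
  have he' : (0 : ℚ) < e := by exact_mod_cast he
  rw [div_le_div_iff₀ hb' he'] at h
  exact_mod_cast h

lemma Desc.second_facet (hM : Desc Q M) {A H P : AddSubmonoid (L d)} (h1 : IsFacetOf Q A H)
    (h2 : IsFacetOf Q H P) : ∃ H', H' ≠ H ∧ IsFacetOf Q A H' ∧ IsFacetOf Q H' P := by
  have hA := h1.1
  have hH := h1.2.1
  have hP := h2.2.1
  have hAP : A ≤ P := h1.2.2.1.trans h2.2.2.1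
  obtain ⟨u, hu, huA⟩ := SetLike.exists_of_lt h1.lt
  obtain ⟨p, hp, hpH⟩ := SetLike.exists_of_lt h2.lt
  obtain ⟨lam, hl0, hl⟩ := hH.exists_lam
  obtain ⟨a, ha, hav⟩ := hM.relpt hA
  have hne : (M.filter fun μ => Van μ A ∧ 0 < μ u).Nonempty := by
    by_contra hcon
    rw [Finset.not_nonempty_iff_eq_empty, Finset.filter_eq_empty_iff] at hcon
    refine huA ((hM.face_mem_iff hA).2 ⟨hH.le hu, fun μ hμ hv => ?_⟩)
    have a1 := hcon hμ
    have a2 := hM.pos hμ (hH.le hu)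
    by_contra h0
    exact a1 ⟨hv, lt_of_le_of_ne a2 (Ne.symm h0)⟩
  obtain ⟨μ0, hμ0, hmin⟩ := Finset.exists_min_image _
    (fun μ : L d →ₗ[ℤ] ℤ => (μ p : ℚ) / (μ u : ℚ)) hne
  rw [Finset.mem_filter] at hμ0
  obtain ⟨hμ0M, hμ0A, hμ0u⟩ := hμ0
  have hzval : ∀ μ : L d →ₗ[ℤ] ℤ, μ (μ0 u • p - μ0 p • u) = μ0 u * μ p - μ0 p * μ u := by
    intro μ
    rw [map_sub, map_zsmul, map_zsmul, smul_eq_mul, smul_eq_mul]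
  obtain ⟨N, hN⟩ := hM.bump (q := a) (x := μ0 u • p - μ0 p • u) (hA.le ha) (by
    intro μ hμ h0
    have hv := hav μ hμ h0
    rw [hzval]
    have b1 := hM.pos hμ (hH.le hu)
    have b2 := hM.pos hμ (hP.le hp)
    rcases b1.eq_or_lt with h | h
    · rw [← h, mul_zero, sub_zero]; exact mul_nonneg hμ0u.le b2
    · have := ratio_le hμ0u h (hmin μ (by simp [hμ, hv, h]))
      linarith)
  have hqval : ∀ μ : L d →ₗ[ℤ] ℤ, μ (N • a + (μ0 u • p - μ0 p • u))
      = N * μ a + (μ0 u * μ p - μ0 p * μ u) := by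
    intro μ
    rw [map_add, hzval, map_nsmul, nsmul_eq_mul]
  set q := N • a + (μ0 u • p - μ0 p • u) with hq
  have hqP : q ∈ P := by
    refine (hM.face_mem_iff hP).2 ⟨hN, fun μ hμ hv => ?_⟩
    rw [hqval, hv a (hAP ha), hv p hp, hv u (h2.2.2.1 hu)]; ring
  have hqC : q ∈ cutF P μ0 := mem_cutF.2 ⟨hqP, by rw [hqval, hμ0A a ha]; ring⟩
  have hqH : q ∉ H := by
    intro hcon
    have e1 := ((hl q).1 hcon).2
    rw [hqval, ((hl a).1 (h1.2.2.1 ha)).2, ((hl u).1 hu).2, mul_zero, mul_zero, zero_add,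
      sub_zero] at e1
    rcases mul_eq_zero.1 e1 with h | h
    · omega
    · exact hpH ((hl p).2 ⟨hP.le hp, h⟩)
  have hC := hM.cut_face hP hμ0M
  refine ⟨cutF P μ0, fun h => hqH (h ▸ hqC), facets_between hA hC hP ?_ ?_ ?_⟩
  · refine lt_of_le_of_ne (fun x hx => mem_cutF.2 ⟨hAP hx, hμ0A x hx⟩) ?_
    intro h
    exact hqH (h1.2.2.1 (h ▸ hqC))
  · refine lt_of_le_of_ne (cutF_le _ _) ?_
    intro h
    have := (mem_cutF.1 (h.symm ▸ h2.2.2.1 hu : u ∈ cutF P μ0)).2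
    omega
  · have := h1.2.2.2
    have := h2.2.2.2
    omega

lemma inter_eq {A H1 H2 P : AddSubmonoid (L d)} (a1 : IsFacetOf Q A H1)
    (a2 : IsFacetOf Q A H2) (b1 : IsFacetOf Q H1 P) (b2 : IsFacetOf Q H2 P) (hne : H1 ≠ H2)
    {x : L d} (hx1 : x ∈ H1) (hx2 : x ∈ H2) : x ∈ A := by
  obtain ⟨l1, p1, e1⟩ := a1.2.1.exists_lam
  obtain ⟨l2, p2, e2⟩ := a2.2.1.exists_lam
  have hF : IsFace Q (H1 ⊓ H2) := by
    refine IsFace.mk' (l1 + l2) (fun x hx => add_nonneg (p1 x hx) (p2 x hx)) fun x => ?_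
    rw [AddSubmonoid.mem_inf, e1, e2, LinearMap.add_apply]
    constructor
    · rintro ⟨⟨h1, h2⟩, _, h3⟩; exact ⟨h1, by omega⟩
    · rintro ⟨h1, h2⟩
      have := p1 x h1
      have := p2 x h1
      exact ⟨⟨h1, by omega⟩, h1, by omega⟩
  have hlt : H1 ⊓ H2 < H1 := by
    refine lt_of_le_of_ne inf_le_left fun h => hne ?_
    refine face_eq_of_dim a1.2.1 a2.2.1 (inf_eq_left.1 h) ?_
    have := b1.2.2.2
    have := b2.2.2.2
    omega
  have hd := faceDim_lt hF a1.2.1 hlt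
  have : A = H1 ⊓ H2 := face_eq_of_dim a1.1 hF (le_inf a1.2.2.1 a2.2.2.1) (by
    have := a1.2.2.2
    omega)
  rw [this]
  exact ⟨hx1, hx2⟩

lemma three_signs {a b c x1 x2 y1 y3 z2 z3 : ℤ} (hc : c ≠ 0)
    (hx1 : 0 < x1) (hx2 : 0 < x2) (hy1 : 0 < y1) (hy3 : 0 < y3) (hz2 : 0 < z2) (hz3 : 0 < z3)
    (e1 : b * z2 + c * z3 = 0) (e2 : a * y1 + c * y3 = 0) (e3 : a * x1 + b * x2 = 0) :
    False := by
  rcases lt_or_gt_of_ne hc with h | h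
  · have h1 : 0 < b := by
      by_contra hb
      have := mul_nonneg (a := -b) (b := z2) (by omega) hz2.le
      have := mul_pos (a := -c) (b := z3) (by omega) hz3
      linarith
    have h2 : 0 < a := by
      by_contra hb
      have := mul_nonneg (a := -a) (b := y1) (by omega) hy1.le
      have := mul_pos (a := -c) (b := y3) (by omega) hy3
      linarith
    have := mul_pos h1 hx2
    have := mul_pos h2 hx1
    linarith
  · have h1 : b < 0 := by
      by_contra hb
      have := mul_nonneg (a := b) (b := z2) (by omega) hz2.le
      have := mul_pos (a := c) (b := z3) (by omega) hz3
      linarith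
    have h2 : a < 0 := by
      by_contra hb
      have := mul_nonneg (a := a) (b := y1) (by omega) hy1.le
      have := mul_pos (a := c) (b := y3) (by omega) hy3
      linarith
    have := mul_pos (a := -b) (by omega) hx2
    have := mul_pos (a := -a) (by omega) hx1
    linarith

lemma Desc.no_third (hM : Desc Q M) {A H1 H2 H3 P : AddSubmonoid (L d)}
    (a1 : IsFacetOf Q A H1) (a2 : IsFacetOf Q A H2) (a3 : IsFacetOf Q A H3)
    (b1 : IsFacetOf Q H1 P) (b2 : IsFacetOf Q H2 P) (b3 : IsFacetOf Q H3 P)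
    (h12 : H1 ≠ H2) (h13 : H1 ≠ H3) (h23 : H2 ≠ H3) : False := by
  obtain ⟨x1, m1, n1⟩ := SetLike.exists_of_lt a1.lt
  obtain ⟨x2, m2, n2⟩ := SetLike.exists_of_lt a2.lt
  obtain ⟨x3, m3, n3⟩ := SetLike.exists_of_lt a3.lt
  obtain ⟨l1, p1, e1⟩ := a1.2.1.exists_lam
  obtain ⟨l2, p2, e2⟩ := a2.2.1.exists_lam
  obtain ⟨l3, p3, e3⟩ := a3.2.1.exists_lam
  have q1 := a1.2.1.le m1
  have q2 := a2.2.1.le m2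
  have q3 := a3.2.1.le m3
  have pos : ∀ {l : L d →ₗ[ℤ] ℤ} {H : AddSubmonoid (L d)} {x : L d},
      (∀ x ∈ Q, 0 ≤ l x) → (∀ x, x ∈ H ↔ x ∈ Q ∧ l x = 0) → x ∈ Q → x ∉ H → 0 < l x := by
    intro l H x hp he hx hn
    exact lt_of_le_of_ne (hp x hx) fun h => hn ((he x).2 ⟨hx, h.symm⟩)
  have l12 := pos p1 e1 q2 fun h => n2 (inter_eq a1 a2 b1 b2 h12 h m2)
  have l13 := pos p1 e1 q3 fun h => n3 (inter_eq a1 a3 b1 b3 h13 h m3)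
  have l21 := pos p2 e2 q1 fun h => n1 (inter_eq a1 a2 b1 b2 h12 m1 h)
  have l23 := pos p2 e2 q3 fun h => n3 (inter_eq a2 a3 b2 b3 h23 h m3)
  have l31 := pos p3 e3 q1 fun h => n1 (inter_eq a1 a3 b1 b3 h13 m1 h)
  have l32 := pos p3 e3 q2 fun h => n2 (inter_eq a2 a3 b2 b3 h23 m2 h)
  have v1 : Van l1 H1 := fun x hx => ((e1 x).1 hx).2
  have v2 : Van l2 H2 := fun x hx => ((e2 x).1 hx).2
  have v3 : Van l3 H3 := fun x hx => ((e3 x).1 hx).2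
  -- a vector of `spn H1`
  have hz1 : l1 x2 • x3 - l1 x3 • x2 ∈ spn H1 := by
    refine hM.facet_ker b1 v1 (b2.2.2.1 m2) l12.ne' ?_ ?_
    · exact Submodule.sub_mem _ (Submodule.smul_mem _ _ (subset_spn (b3.2.2.1 m3)))
        (Submodule.smul_mem _ _ (subset_spn (b2.2.2.1 m2)))
    · rw [map_sub, map_zsmul, map_zsmul, smul_eq_mul, smul_eq_mul]; ring
  have hzA : l2 x1 • (l1 x2 • x3 - l1 x3 • x2) - l2 (l1 x2 • x3 - l1 x3 • x2) • x1 ∈ spn A := by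
    refine hM.facet_ker a1 (v2.mono a2.2.2.1) m1 l21.ne' ?_ ?_
    · exact Submodule.sub_mem _ (Submodule.smul_mem _ _ hz1)
        (Submodule.smul_mem _ _ (subset_spn m1))
    · rw [map_sub, map_zsmul, map_zsmul, smul_eq_mul, smul_eq_mul]; ring
  have key : ∀ l : L d →ₗ[ℤ] ℤ, Van l A →
      (-(l2 (l1 x2 • x3 - l1 x3 • x2))) * l x1 + (-(l2 x1 * l1 x3)) * l x2
        + (l2 x1 * l1 x2) * l x3 = 0 := by
    intro l hl
    have := Van.closure hl hzA
    rw [map_sub, map_zsmul, map_zsmul, map_sub, map_zsmul, map_zsmul] at this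
    simp only [smul_eq_mul] at this
    linarith
  have k1 := key l1 (v1.mono a1.2.2.1)
  have k2 := key l2 (v2.mono a2.2.2.1)
  have k3 := key l3 (v3.mono a3.2.2.1)
  rw [v1 x1 m1, mul_zero, zero_add] at k1
  rw [v2 x2 m2, mul_zero, add_zero] at k2
  rw [v3 x3 m3, mul_zero, add_zero] at k3
  exact three_signs (mul_pos l21 l12).ne' l31 l32 l21 l23 l12 l13 k1 k2 k3

/-- The incidence numbers, extended by zero. -/
def inc (Q : AddSubmonoid (L d)) (ε : AddSubmonoid (L d) → AddSubmonoid (L d) → ℤ)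
    (G' G : AddSubmonoid (L d)) : ℤ := if IsFacetOf Q G' G then ε G' G else 0

lemma inc_ne {ε : AddSubmonoid (L d) → AddSubmonoid (L d) → ℤ} {G' G : AddSubmonoid (L d)}
    (h : inc Q ε G' G ≠ 0) : IsFacetOf Q G' G := by
  by_contra hn
  exact h (if_neg hn)

lemma Desc.inc_sq (hM : Desc Q M) {ε : AddSubmonoid (L d) → AddSubmonoid (L d) → ℤ}
    (hε : IsIncidence Q ε) {A P : AddSubmonoid (L d)} (T : Finset (AddSubmonoid (L d)))
    (hT : ∀ H, IsFacetOf Q A H → IsFacetOf Q H P → H ∈ T) :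
    ∑ H ∈ T, inc Q ε A H * inc Q ε H P = 0 := by
  by_cases hex : ∃ H, IsFacetOf Q A H ∧ IsFacetOf Q H P
  · obtain ⟨H, hA, hP⟩ := hex
    obtain ⟨H', hne, hA', hP'⟩ := hM.second_facet hA hP
    rw [Finset.sum_eq_add H H' hne.symm]
    · simp only [inc, if_pos hA, if_pos hA', if_pos hP, if_pos hP']
      exact hε.2 A H H' P hne.symm hA hP hA' hP'
    · rintro K _ ⟨hK1, hK2⟩
      by_contra h0
      exact hM.no_third hA hA' (inc_ne (left_ne_zero_of_mul h0)) hP hP'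
        (inc_ne (right_ne_zero_of_mul h0)) hne.symm hK1.symm hK2.symm
    · intro h; exact absurd (hT H hA hP) h
    · intro h; exact absurd (hT H' hA' hP') h
  · refine Finset.sum_eq_zero fun H _ => ?_
    by_contra h0
    exact hex ⟨H, inc_ne (left_ne_zero_of_mul h0), inc_ne (right_ne_zero_of_mul h0)⟩

end

/-! ### Acyclicity of intervals of faces by a sweep (line shelling) argument -/

section
variable {d : ℕ} {Q : AddSubmonoid (L d)} {M : Finset (L d →ₗ[ℤ] ℤ)}

lemma exists_generic (P : AddSubmonoid (L d)) (Φ : Finset (L d →ₗ[ℤ] ℤ))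
    (h : ∀ φ ∈ Φ, ¬ Van φ P) : ∃ y ∈ P, ∀ φ ∈ Φ, φ y ≠ 0 := by
  induction Φ using Finset.induction_on with
  | empty => exact ⟨0, P.zero_mem, by simp⟩
  | insert φ Φ hφ ih =>
    obtain ⟨y, hy, hy'⟩ := ih fun ψ hψ => h ψ (Finset.mem_insert_of_mem hψ)
    by_cases h0 : φ y = 0
    · have hv := h φ (Finset.mem_insert_self _ _)
      unfold Van at hv
      push Not at hv
      obtain ⟨p, hp, hp0⟩ := hv
      refine ⟨(∑ ψ ∈ Φ, (ψ p).natAbs + 1) • y + p,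
        P.add_mem (P.nsmul_mem hy _) hp, fun ψ hψ => ?_⟩
      rw [map_add, map_nsmul, nsmul_eq_mul]
      rcases Finset.mem_insert.1 hψ with rfl | hψ
      · rw [h0, mul_zero, zero_add]; exact hp0
      · have hle : (ψ p).natAbs ≤ ∑ ψ ∈ Φ, (ψ p).natAbs :=
          Finset.single_le_sum (f := fun ψ : L d →ₗ[ℤ] ℤ => (ψ p).natAbs)
            (fun _ _ => Nat.zero_le _) hψ
        generalize hN : (∑ ψ ∈ Φ, (ψ p).natAbs + 1) = N at *
        have hNpos : (0 : ℤ) ≤ N := by positivity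
        intro hcon
        have hψy := hy' ψ hψ
        rcases lt_or_gt_of_ne hψy with hh | hh
        · have := mul_le_mul_of_nonneg_left (show 1 ≤ -(ψ y) by omega) hNpos
          have e : (N : ℤ) * -(ψ y) = -((N : ℤ) * ψ y) := by ring
          omega
        · have := mul_le_mul_of_nonneg_left (show 1 ≤ ψ y by omega) hNpos
          omega
    · exact ⟨y, hy, fun ψ hψ => by
        rcases Finset.mem_insert.1 hψ with rfl | hψ
        · exact h0
        · exact hy' ψ hψ⟩

/-- The faces between `A` and `P` that are visible in direction `x`. -/
def vis (M : Finset (L d →ₗ[ℤ] ℤ)) (Δ : Finset (AddSubmonoid (L d)))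
    (A P : AddSubmonoid (L d)) (x : L d) : Finset (AddSubmonoid (L d)) :=
  Δ.filter fun G => A ≤ G ∧ G ≤ P ∧ ∀ μ ∈ M, Van μ G → ¬ Van μ P → 0 < μ x

/-- The matrix of the vertical differential. -/
def tV (K : Type) [Field K] (Q : AddSubmonoid (L d))
    (ε : AddSubmonoid (L d) → AddSubmonoid (L d) → ℤ) (G G' : AddSubmonoid (L d)) : K :=
  ((inc Q ε G' G : ℤ) : K)

lemma inc_self (ε : AddSubmonoid (L d) → AddSubmonoid (L d) → ℤ) (G : AddSubmonoid (L d)) :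
    inc Q ε G G = 0 := by
  by_contra h
  exact (inc_ne h).lt.ne rfl

lemma Desc.vis_acyc (K : Type) [Field K] (hM : Desc Q M)
    {ε : AddSubmonoid (L d) → AddSubmonoid (L d) → ℤ}
    (hε : IsIncidence Q ε) {Δ : Finset (AddSubmonoid (L d))} (hΔ : IsPolyhedralComplex Q Δ)
    {A : AddSubmonoid (L d)} (hA : IsFace Q A) (n : ℕ) :
    ∀ (P : AddSubmonoid (L d)) (x : L d), faceDim P = n → P ∈ Δ → A ≤ P →
      (∀ μ ∈ M, Van μ P → μ x = 0) → (∃ μ ∈ M, Van μ A ∧ 0 < μ x) →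
      Acyc (tV K Q ε) (vis M Δ A P x) := by
  induction n using Nat.strong_induction_on with
  | _ n ih =>
  intro P x hn hPΔ hAP hxP hex
  have hP : IsFace Q P := hΔ.1 P hPΔ
  -- a generic interior point
  obtain ⟨y, hyP, hyne⟩ := exists_generic P
    ((M.filter fun μ => ¬ Van μ P) ∪
      ((M ×ˢ M).image fun p => p.1 x • p.2 - p.2 x • p.1).filter fun φ => ¬ Van φ P) (by
      intro φ hφ
      rcases Finset.mem_union.1 hφ with h | h
      · exact (Finset.mem_filter.1 h).2
      · exact (Finset.mem_filter.1 h).2)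
  have hy : ∀ μ ∈ M, ¬ Van μ P → 0 < μ y := by
    intro μ hμ hv
    exact lt_of_le_of_ne (hM.pos hμ (hP.le hyP))
      (Ne.symm (hyne μ (Finset.mem_union_left _ (by simp [hμ, hv]))))
  have hgen : ∀ μ ∈ M, ∀ ν ∈ M, μ x * ν y = ν x * μ y → ∀ p ∈ P, μ x * ν p = ν x * μ p := by
    intro μ hμ ν hν he
    have hv : Van (μ x • ν - ν x • μ) P := by
      by_contra hv
      refine hyne (μ x • ν - ν x • μ) (Finset.mem_union_right _ ?_) ?_
      · rw [Finset.mem_filter]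
        exact ⟨Finset.mem_image.2 ⟨(μ, ν), by simp [hμ, hν], rfl⟩, hv⟩
      · simp [he]
    intro p hp
    have := hv p hp
    simp only [LinearMap.sub_apply, LinearMap.smul_apply, smul_eq_mul] at this
    omega
  clear hyne
  let s : (L d →ₗ[ℤ] ℤ) → ℚ := fun μ => (μ x : ℚ) / (μ y : ℚ)
  have hycast : ∀ μ ∈ M, ¬ Van μ P → (0 : ℚ) < (μ y : ℚ) := fun μ hμ hv => by
    exact_mod_cast hy μ hμ hv
  have slt : ∀ μ ∈ M, ∀ ν ∈ M, ¬ Van μ P → ¬ Van ν P →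
      (s μ < s ν ↔ μ x * ν y < ν x * μ y) := by
    intro μ hμ ν hν h1 h2
    simp only [s]
    rw [div_lt_div_iff₀ (hycast μ hμ h1) (hycast ν hν h2)]
    exact_mod_cast Iff.rfl
  have seq : ∀ μ ∈ M, ∀ ν ∈ M, ¬ Van μ P → ¬ Van ν P →
      (s μ = s ν ↔ μ x * ν y = ν x * μ y) := by
    intro μ hμ ν hν h1 h2
    simp only [s]
    rw [div_eq_div_iff (hycast μ hμ h1).ne' (hycast ν hν h2).ne']
    exact_mod_cast Iff.rfl
  have spos : ∀ μ ∈ M, ¬ Van μ P → (0 < s μ ↔ 0 < μ x) := by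
    intro μ hμ h1
    simp only [s]
    rw [div_pos_iff_of_pos_right (hycast μ hμ h1)]
    exact_mod_cast Iff.rfl
  -- the relevant functionals
  let J : AddSubmonoid (L d) → Finset (L d →ₗ[ℤ] ℤ) := fun G =>
    M.filter fun μ => Van μ G ∧ ¬ Van μ P
  have hJ : ∀ G μ, μ ∈ J G ↔ μ ∈ M ∧ Van μ G ∧ ¬ Van μ P := by
    intro G μ; simp [J]
  obtain ⟨μ1, hμ1M, hμ1A, hμ1x⟩ := hex
  have hμ1P : ¬ Van μ1 P := fun h => by
    have := hxP μ1 hμ1M h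
    omega
  obtain ⟨μm, hμm, hmax⟩ := Finset.exists_max_image (J A) s ⟨μ1, (hJ _ _).2 ⟨hμ1M, hμ1A, hμ1P⟩⟩
  have hmpos : 0 < s μm :=
    lt_of_lt_of_le ((spos μ1 hμ1M hμ1P).2 hμ1x) (hmax μ1 ((hJ _ _).2 ⟨hμ1M, hμ1A, hμ1P⟩))
  obtain ⟨hμmM, hμmA, hμmP⟩ := (hJ _ _).1 hμm
  let hh : AddSubmonoid (L d) → ℚ := fun G =>
    (insert (s μm) ((J G).image s)).min' (Finset.insert_nonempty _ _)
  have hh_le_m : ∀ G, hh G ≤ s μm := fun G =>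
    Finset.min'_le _ _ (Finset.mem_insert_self _ _)
  have hh_le : ∀ G, ∀ μ ∈ J G, hh G ≤ s μ := fun G μ hμ =>
    Finset.min'_le _ _ (Finset.mem_insert_of_mem (Finset.mem_image_of_mem s hμ))
  have hh_mem : ∀ G, hh G = s μm ∨ ∃ μ ∈ J G, s μ = hh G := by
    intro G
    have := Finset.min'_mem (insert (s μm) ((J G).image s)) (Finset.insert_nonempty _ _)
    rcases Finset.mem_insert.1 this with h | h
    · exact Or.inl h
    · exact Or.inr (Finset.mem_image.1 h)
  -- properties of the cuts
  have zval : ∀ μ0 μ : L d →ₗ[ℤ] ℤ, μ (μ0 y • x - μ0 x • y) = μ0 y * μ x - μ0 x * μ y := by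
    intro μ0 μ
    rw [map_sub, map_zsmul, map_zsmul, smul_eq_mul, smul_eq_mul]
  have zP : ∀ μ0 : L d →ₗ[ℤ] ℤ, ∀ μ ∈ M, Van μ P → μ (μ0 y • x - μ0 x • y) = 0 := by
    intro μ0 μ hμ hv
    rw [zval, hxP μ hμ hv, hv y hyP]; ring
  have zpos : ∀ μ0 ∈ M, ∀ μ ∈ M, ¬ Van μ0 P → ¬ Van μ P →
      (0 < μ (μ0 y • x - μ0 x • y) ↔ s μ0 < s μ) := by
    intro μ0 hμ0 μ hμ h1 h2
    rw [zval, slt μ0 hμ0 μ hμ h1 h2, mul_comm (μ0 y)]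
    omega
  have zzero : ∀ μ0 ∈ M, ∀ μ ∈ M, ¬ Van μ0 P → ¬ Van μ P →
      (μ (μ0 y • x - μ0 x • y) = 0 ↔ s μ = s μ0) := by
    intro μ0 hμ0 μ hμ h1 h2
    rw [zval, seq μ hμ μ0 hμ0 h2 h1, mul_comm (μ0 y)]
    omega
  -- proportional functionals
  have prop : ∀ μ0 ∈ M, ∀ μ ∈ M, ¬ Van μ0 P → ¬ Van μ P → 0 < s μ0 → s μ = s μ0 →
      ∀ p ∈ P, μ0 p = 0 → μ p = 0 := by
    intro μ0 hμ0 μ hμ h1 h2 h3 h4 p hp hp0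
    have := hgen μ hμ μ0 hμ0 ((seq μ hμ μ0 hμ0 h2 h1).1 h4) p hp
    rw [hp0, mul_zero] at this
    have h5 := (spos μ0 hμ0 h1).1 h3
    rcases mul_eq_zero.1 this.symm with h | h
    · omega
    · exact h
  have hcut_lt : ∀ μ0 : L d →ₗ[ℤ] ℤ, ¬ Van μ0 P → cutF P μ0 < P := by
    intro μ0 h1
    refine lt_of_le_of_ne (cutF_le _ _) fun h => h1 fun p hp => ?_
    exact (mem_cutF.1 (h.symm ▸ hp : p ∈ cutF P μ0)).2
  refine Acyc.of_fibres (fun G => OrderDual.toDual (hh G)) _ _ rfl ?_ ?_ ?_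
  · intro G hG G' hG' hne
    have hlt : IsFacetOf Q G' G := inc_ne (ε := ε) fun h => hne (by simp [tV, h])
    refine OrderDual.toDual_le_toDual.2 ?_
    refine Finset.min'_subset _ (Finset.insert_subset_insert _ (Finset.image_subset_image ?_))
    intro μ hμ
    rw [hJ] at hμ ⊢
    exact ⟨hμ.1, hμ.2.1.mono hlt.2.2.1, hμ.2.2⟩
  · intro G hG G' hG'
    have h2 := hM.inc_sq hε (A := G') (P := G) (vis M Δ A P x) (by
      intro H h1 h2
      simp only [vis, Finset.mem_filter] at hG hG' ⊢
      exact ⟨hΔ.2 G hG.1 H h1.2.1 h2.2.2.1, hG'.2.1.trans h1.2.2.1, h2.2.2.1.trans hG.2.2.1,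
        fun μ hμ hv => hG'.2.2.2 μ hμ (hv.mono h1.2.2.1)⟩)
    have h3 := congrArg (fun z : ℤ => (z : K)) h2
    simp only [Int.cast_sum, Int.cast_mul, Int.cast_zero] at h3
    rw [← h3]
    exact Finset.sum_congr rfl fun H _ => by simp only [tV]; ring
  · intro G0 hG0 T hT
    have hfilt : T = (vis M Δ A P x).filter (fun G => hh G = hh G0) := by
      ext G
      rw [hT, Finset.mem_filter]
      exact and_congr_right fun _ => OrderDual.toDual_inj
    rw [hfilt]
    have hG0' := hG0
    simp only [vis, Finset.mem_filter] at hG0'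
    obtain ⟨hG0Δ, hAG0, hG0P, hG0x⟩ := hG0'
    rcases (hh_le_m G0).lt_or_eq with hlt | heq
    · -- a facet which is not the last one
      obtain ⟨μ0, hμ0, hμ0s⟩ : ∃ μ ∈ J G0, s μ = hh G0 := by
        rcases hh_mem G0 with h | h
        · exact absurd h hlt.ne
        · exact h
      obtain ⟨hμ0M, hμ0G, hμ0P⟩ := (hJ _ _).1 hμ0
      rw [← hμ0s] at hlt ⊢
      have hμ0pos : 0 < s μ0 := (spos μ0 hμ0M hμ0P).2 (hG0x μ0 hμ0M hμ0G hμ0P)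
      have hH : IsFace Q (cutF P μ0) := hM.cut_face hP hμ0M
      have hHΔ : cutF P μ0 ∈ Δ := hΔ.2 P hPΔ _ hH (cutF_le _ _)
      have hG0H : G0 ≤ cutF P μ0 := fun g hg => mem_cutF.2 ⟨hG0P hg, hμ0G g hg⟩
      obtain ⟨g, hg, hgv⟩ := hM.relpt (hΔ.1 G0 hG0Δ)
      obtain ⟨N, hN⟩ := hM.bump (q := g) (x := μ0 y • x - μ0 x • y) (hH.le (hG0H hg)) (by
        intro μ hμ h0
        by_cases hv : Van μ P
        · exact (zP μ0 μ hμ hv).ge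
        · have h1 := hh_le G0 μ ((hJ _ _).2 ⟨hμ, hgv μ hμ h0, hv⟩)
          rw [← hμ0s] at h1
          rcases h1.lt_or_eq with h2 | h2
          · exact ((zpos μ0 hμ0M μ hμ hμ0P hv).2 h2).le
          · exact ((zzero μ0 hμ0M μ hμ hμ0P hv).2 h2.symm).ge)
      have hwval : ∀ μ : L d →ₗ[ℤ] ℤ, μ (N • g + (μ0 y • x - μ0 x • y)) =
          N * μ g + μ (μ0 y • x - μ0 x • y) := by
        intro μ; rw [map_add, map_nsmul, nsmul_eq_mul]
      have hw : N • g + (μ0 y • x - μ0 x • y) ∈ cutF P μ0 := by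
        refine mem_cutF.2 ⟨(hM.face_mem_iff hP).2 ⟨hN, fun μ hμ hv => ?_⟩, ?_⟩
        · rw [hwval, hv g (hG0P hg), zP μ0 μ hμ hv]; ring
        · rw [hwval, hμ0G g hg, zval]; ring
      have hI : ∀ μ ∈ M, ¬ Van μ P → (Van μ (cutF P μ0) ↔ s μ = s μ0) := by
        intro μ hμ hv
        constructor
        · intro h1
          have h2 := h1 _ hw
          rw [hwval, h1 g (hG0H hg), mul_zero, zero_add] at h2
          exact (zzero μ0 hμ0M μ hμ hμ0P hv).1 h2
        · intro h1 p hp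
          exact prop μ0 hμ0M μ hμ hμ0P hv hμ0pos h1 p (mem_cutF.1 hp).1 (mem_cutF.1 hp).2
      have hacyc := ih (faceDim (cutF P μ0)) (hn ▸ faceDim_lt hH hP (hcut_lt μ0 hμ0P))
        (cutF P μ0) (μ0 y • x - μ0 x • y) rfl hHΔ (hAG0.trans hG0H) (by
          intro μ hμ hv
          by_cases hvP : Van μ P
          · exact zP μ0 μ hμ hvP
          · exact (zzero μ0 hμ0M μ hμ hμ0P hvP).2 ((hI μ hμ hvP).1 hv))
        ⟨μm, hμmM, hμmA, (zpos μ0 hμ0M μm hμmM hμ0P hμmP).2 hlt⟩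
      convert hacyc using 1
      ext G
      simp only [vis, Finset.mem_filter]
      constructor
      · rintro ⟨⟨hGΔ, hAG, hGP, hGx⟩, hGh⟩
        obtain ⟨ν, hν, hνs⟩ : ∃ μ ∈ J G, s μ = hh G := by
          rcases hh_mem G with h | h
          · exact absurd (hGh.symm.trans h) hlt.ne
          · exact h
        obtain ⟨hνM, hνG, hνP⟩ := (hJ _ _).1 hν
        have hνpos : 0 < s ν := (spos ν hνM hνP).2 (hGx ν hνM hνG hνP)
        refine ⟨hGΔ, hAG, fun p hp => mem_cutF.2 ⟨hGP hp, ?_⟩, fun μ hμ hv hvH => ?_⟩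
        · exact prop ν hνM μ0 hμ0M hνP hμ0P hνpos (hGh.symm.trans hνs.symm) p (hGP hp)
            (hνG p hp)
        · have hvP : ¬ Van μ P := fun h => hvH (h.mono (cutF_le _ _))
          refine (zpos μ0 hμ0M μ hμ hμ0P hvP).2 (lt_of_le_of_ne ?_ ?_)
          · rw [← hGh]; exact hh_le G μ ((hJ _ _).2 ⟨hμ, hv, hvP⟩)
          · intro h; exact hvH ((hI μ hμ hvP).2 h.symm)
      · rintro ⟨hGΔ, hAG, hGH, hGz⟩
        have hsle : ∀ μ ∈ J G, s μ0 ≤ s μ := by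
          intro μ hμ
          obtain ⟨hμM, hμG, hμP⟩ := (hJ _ _).1 hμ
          by_cases hvH : Van μ (cutF P μ0)
          · exact ((hI μ hμM hμP).1 hvH).ge
          · exact ((zpos μ0 hμ0M μ hμM hμ0P hμP).1 (hGz μ hμM hμG hvH)).le
        have hμ0JG : μ0 ∈ J G := (hJ _ _).2 ⟨hμ0M, fun p hp => (mem_cutF.1 (hGH hp)).2, hμ0P⟩
        refine ⟨⟨hGΔ, hAG, hGH.trans (cutF_le _ _), fun μ hμ hv hvP => ?_⟩, ?_⟩
        · exact (spos μ hμ hvP).1 (lt_of_lt_of_le hμ0pos (hsle μ ((hJ _ _).2 ⟨hμ, hv, hvP⟩)))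
        · refine le_antisymm (hh_le G μ0 hμ0JG) ?_
          rcases hh_mem G with h | ⟨ν, hν, hνs⟩
          · rw [h]; exact hlt.le
          · rw [← hνs]; exact hsle ν hν
    · -- the last facet, together with `P`
      rw [heq]
      have hH : IsFace Q (cutF P μm) := hM.cut_face hP hμmM
      have hHΔ : cutF P μm ∈ Δ := hΔ.2 P hPΔ _ hH (cutF_le _ _)
      have hAH : A ≤ cutF P μm := fun g hg => mem_cutF.2 ⟨hAP hg, hμmA g hg⟩
      obtain ⟨g, hg, hgv⟩ := hM.relpt hA
      obtain ⟨N, hN⟩ := hM.bump (q := g) (x := -(μm y • x - μm x • y)) (hA.le hg) (by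
        intro μ hμ h0
        rw [map_neg]
        by_cases hv : Van μ P
        · rw [zP μm μ hμ hv]; simp
        · have h1 := hmax μ ((hJ _ _).2 ⟨hμ, hgv μ hμ h0, hv⟩)
          have h2 := (zpos μm hμmM μ hμ hμmP hv).not.2 (not_lt.2 h1)
          omega)
      have hwval : ∀ μ : L d →ₗ[ℤ] ℤ, μ (N • g + -(μm y • x - μm x • y)) =
          N * μ g - μ (μm y • x - μm x • y) := by
        intro μ; rw [map_add, map_nsmul, nsmul_eq_mul, map_neg]; ring
      have hw : N • g + -(μm y • x - μm x • y) ∈ cutF P μm := by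
        refine mem_cutF.2 ⟨(hM.face_mem_iff hP).2 ⟨hN, fun μ hμ hv => ?_⟩, ?_⟩
        · rw [hwval, hv g (hAP hg), zP μm μ hμ hv]; ring
        · rw [hwval, hμmA g hg, zval]; ring
      have hI : ∀ μ ∈ M, ¬ Van μ P → (Van μ (cutF P μm) ↔ s μ = s μm) := by
        intro μ hμ hv
        constructor
        · intro h1
          have h2 := h1 _ hw
          rw [hwval, h1 g (hAH hg), mul_zero, zero_sub, neg_eq_zero] at h2
          exact (zzero μm hμmM μ hμ hμmP hv).1 h2
        · intro h1 p hp
          exact prop μm hμmM μ hμ hμmP hv hmpos h1 p (mem_cutF.1 hp).1 (mem_cutF.1 hp).2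
      have hfacet : IsFacetOf Q (cutF P μm) P := by
        refine facet_of_ker hH hP (hcut_lt μm hμmP) μm fun u hu hu0 => ?_
        refine hM.closure_mem hH fun μ hμ hv => ?_
        by_cases hvP : Van μ P
        · exact hvP.closure hu
        · have h1 : s μ = s μm := (hI μ hμ hvP).1 hv
          have h2 : Van (μ x • μm - μm x • μ) P := by
            intro p hp
            have := hgen μ hμ μm hμmM ((seq μ hμ μm hμmM hvP hμmP).1 h1) p hp
            simp [this]
          have h3 := h2.closure hu
          simp only [LinearMap.sub_apply, LinearMap.smul_apply, smul_eq_mul, hu0, mul_zero,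
            zero_sub, neg_eq_zero] at h3
          have h5 := (spos μm hμmM hμmP).1 hmpos
          rcases mul_eq_zero.1 h3 with h | h
          · omega
          · exact h
      have hset : (vis M Δ A P x).filter (fun G => hh G = s μm) = {P, cutF P μm} := by
        ext G
        simp only [vis, Finset.mem_filter, Finset.mem_insert, Finset.mem_singleton]
        constructor
        · rintro ⟨⟨hGΔ, hAG, hGP, hGx⟩, hGh⟩
          have hall : ∀ μ ∈ J G, s μ = s μm := by
            intro μ hμ
            refine le_antisymm (hmax μ ?_) (hGh ▸ hh_le G μ hμ)
            obtain ⟨a1, a2, a3⟩ := (hJ _ _).1 hμ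
            exact (hJ _ _).2 ⟨a1, a2.mono hAG, a3⟩
          rcases (J G).eq_empty_or_nonempty with hemp | ⟨ν, hν⟩
          · left
            refine le_antisymm hGP (hM.face_le hP (hΔ.1 G hGΔ) fun μ hμ hv => ?_)
            by_contra hvP
            have : μ ∈ J G := (hJ _ _).2 ⟨hμ, hv, hvP⟩
            rw [hemp] at this
            exact absurd this (Finset.notMem_empty _)
          · right
            obtain ⟨hνM, hνG, hνP⟩ := (hJ _ _).1 hν
            have hνs := hall ν hν
            refine le_antisymm (fun p hp => mem_cutF.2 ⟨hGP hp, ?_⟩)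
              (hM.face_le hH (hΔ.1 G hGΔ) fun μ hμ hv => ?_)
            · exact prop ν hνM μm hμmM hνP hμmP (hνs ▸ hmpos) hνs.symm p (hGP hp) (hνG p hp)
            · by_cases hvP : Van μ P
              · exact hvP.mono (cutF_le _ _)
              · exact (hI μ hμ hvP).2 (hall μ ((hJ _ _).2 ⟨hμ, hv, hvP⟩))
        · rintro (rfl | rfl)
          · refine ⟨⟨hPΔ, hAP, le_rfl, fun μ hμ h1 h2 => absurd h1 h2⟩, ?_⟩
            rcases hh_mem G with h | ⟨ν, hν, hνs⟩
            · exact h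
            · obtain ⟨_, h1, h2⟩ := (hJ _ _).1 hν
              exact absurd h1 h2
          · refine ⟨⟨hHΔ, hAH, cutF_le _ _, fun μ hμ h1 h2 => ?_⟩, ?_⟩
            · have := (hI μ hμ h2).1 h1
              exact (spos μ hμ h2).1 (this ▸ hmpos)
            · rcases hh_mem (cutF P μm) with h | ⟨ν, hν, hνs⟩
              · exact h
              · obtain ⟨h0, h1, h2⟩ := (hJ _ _).1 hν
                rw [← hνs]
                exact (hI ν h0 h2).1 h1
      rw [hset]
      refine Acyc.pair hfacet.lt.ne' ?_ ?_ ?_ ?_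
      · simp only [tV, inc, if_pos hfacet]
        rcases hε.1 _ _ hfacet with h | h <;> rw [h] <;> simp
      · simp [tV, inc_self]
      · simp [tV, inc_self]
      · have : inc Q ε P (cutF P μm) = 0 := by
          by_contra h
          exact lt_asymm (inc_ne h).lt hfacet.lt
        simp [tV, this]

lemma Desc.interval_acyc (K : Type) [Field K] (hM : Desc Q M)
    {ε : AddSubmonoid (L d) → AddSubmonoid (L d) → ℤ}
    (hε : IsIncidence Q ε) {Δ : Finset (AddSubmonoid (L d))} (hΔ : IsPolyhedralComplex Q Δ)
    {A P : AddSubmonoid (L d)} (hA : IsFace Q A) (hP : P ∈ Δ) (hAP : A ≤ P) (hne : P ≠ A) :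
    Acyc (tV K Q ε) (Δ.filter fun G => A ≤ G ∧ G ≤ P) := by
  have hPf := hΔ.1 P hP
  obtain ⟨x, hx, hxv⟩ := hM.relpt hPf
  have hpos : ∀ μ ∈ M, ¬ Van μ P → 0 < μ x := fun μ hμ hv =>
    lt_of_le_of_ne (hM.pos hμ (hPf.le hx)) fun h => hv (hxv μ hμ h.symm)
  have h := hM.vis_acyc K hε hΔ hA _ P x rfl hP hAP (fun μ _ hv => hv x hx) (by
    by_contra hcon
    push Not at hcon
    refine hne (le_antisymm (hM.face_le hPf hA fun μ hμ hv => ?_) hAP)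
    by_contra hvP
    exact absurd (hpos μ hμ hvP) (not_lt.2 (hcon μ hμ hv)))
  convert h using 1
  apply Finset.filter_congr
  intro G _
  exact ⟨fun h => ⟨h.1, h.2, fun μ hμ _ hv => hpos μ hμ hv⟩, fun h => ⟨h.1, h.2.1⟩⟩

end

/-! ### The total complex in a fixed degree -/

section
variable {d : ℕ} {Q : AddSubmonoid (L d)} {M : Finset (L d →ₗ[ℤ] ℤ)}
  {Δ : Finset (AddSubmonoid (L d))} {ε : AddSubmonoid (L d) → AddSubmonoid (L d) → ℤ}

lemma ZP.ext' {x y : ZP Δ} (h1 : ZP.Fc Δ x = ZP.Fc Δ y) (h2 : ZP.Gc Δ x = ZP.Gc Δ y) : x = y :=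
  Subtype.ext (Prod.ext (Subtype.ext h1) (Subtype.ext h2))

lemma ZP.le' (x : ZP Δ) : ZP.Gc Δ x ≤ ZP.Fc Δ x := x.2

lemma ZP.memF (x : ZP Δ) : ZP.Fc Δ x ∈ Δ := x.1.1.2

lemma ZP.memG (x : ZP Δ) : ZP.Gc Δ x ∈ Δ := x.1.2.2

/-- The pair `(F, G)`. -/
def zp {F G : AddSubmonoid (L d)} (hF : F ∈ Δ) (hG : G ∈ Δ) (h : G ≤ F) : ZP Δ :=
  ⟨(⟨F, hF⟩, ⟨G, hG⟩), h⟩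

/-- Pairs above `A`. -/
def XA (Δ : Finset (AddSubmonoid (L d))) (A : AddSubmonoid (L d)) : Finset (ZP Δ) :=
  Finset.univ.filter fun x => A ≤ ZP.Gc Δ x

lemma mem_XA {A : AddSubmonoid (L d)} {x : ZP Δ} : x ∈ XA Δ A ↔ A ≤ ZP.Gc Δ x := by
  simp [XA]

/-- The matrix of the total differential. -/
def tz (Q : AddSubmonoid (L d)) (ε : AddSubmonoid (L d) → AddSubmonoid (L d) → ℤ)
    (x y : ZP Δ) : ℤ :=
  (if ZP.Gc Δ y = ZP.Gc Δ x then
    (-1) ^ faceDim (ZP.Gc Δ x) * inc Q ε (ZP.Fc Δ x) (ZP.Fc Δ y) else 0) +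
  (if ZP.Fc Δ y = ZP.Fc Δ x then inc Q ε (ZP.Gc Δ y) (ZP.Gc Δ x) else 0)

lemma sumF {A : AddSubmonoid (L d)} {x : ZP Δ} (hx : x ∈ XA Δ A) (f : AddSubmonoid (L d) → ℤ) :
    ∑ y ∈ XA Δ A, (if ZP.Gc Δ y = ZP.Gc Δ x then f (ZP.Fc Δ y) else 0) =
      ∑ H ∈ Δ.filter (fun H => ZP.Gc Δ x ≤ H), f H := by
  rw [← Finset.sum_filter]
  refine Finset.sum_bij (fun y _ => ZP.Fc Δ y) ?_ ?_ ?_ ?_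
  · intro y hy
    rw [Finset.mem_filter] at hy ⊢
    exact ⟨y.memF, hy.2 ▸ y.le'⟩
  · intro y hy z hz h
    rw [Finset.mem_filter] at hy hz
    exact ZP.ext' h (hy.2.trans hz.2.symm)
  · intro H hH
    rw [Finset.mem_filter] at hH
    refine ⟨zp hH.1 x.memG hH.2, ?_, rfl⟩
    have := mem_XA.1 hx
    rw [Finset.mem_filter, mem_XA]
    exact ⟨this, rfl⟩
  · intro y _; rfl

lemma sumG {A : AddSubmonoid (L d)} (x : ZP Δ) (f : AddSubmonoid (L d) → ℤ) :
    ∑ y ∈ XA Δ A, (if ZP.Fc Δ y = ZP.Fc Δ x then f (ZP.Gc Δ y) else 0) =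
      ∑ H ∈ Δ.filter (fun H => A ≤ H ∧ H ≤ ZP.Fc Δ x), f H := by
  rw [← Finset.sum_filter]
  refine Finset.sum_bij (fun y _ => ZP.Gc Δ y) ?_ ?_ ?_ ?_
  · intro y hy
    rw [Finset.mem_filter] at hy ⊢
    exact ⟨y.memG, mem_XA.1 hy.1, hy.2 ▸ y.le'⟩
  · intro y hy z hz h
    rw [Finset.mem_filter] at hy hz
    exact ZP.ext' (hy.2.trans hz.2.symm) h
  · intro H hH
    rw [Finset.mem_filter] at hH
    refine ⟨zp x.memF hH.1 hH.2.2, ?_, rfl⟩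
    rw [Finset.mem_filter, mem_XA]
    exact ⟨hH.2.1, rfl⟩
  · intro y _; rfl

lemma tz_sq (hM : Desc Q M) (hε : IsIncidence Q ε) (hΔ : IsPolyhedralComplex Q Δ)
    {A : AddSubmonoid (L d)} {x z : ZP Δ} (hx : x ∈ XA Δ A) (hz : z ∈ XA Δ A) :
    ∑ y ∈ XA Δ A, tz Q ε x y * tz Q ε y z = 0 := by
  obtain ⟨f1, hf1⟩ : ∃ f : AddSubmonoid (L d) → ℤ, ∀ H, f H = (if ZP.Gc Δ z = ZP.Gc Δ x then
            (inc Q ε (ZP.Fc Δ x) H * inc Q ε H (ZP.Fc Δ z)) else 0) +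
          (if ZP.Fc Δ z = H then (-1) ^ faceDim (ZP.Gc Δ x) * inc Q ε (ZP.Fc Δ x) (ZP.Fc Δ z) *
            inc Q ε (ZP.Gc Δ z) (ZP.Gc Δ x) else 0) := ⟨_, fun _ => rfl⟩
  obtain ⟨f2, hf2⟩ : ∃ f : AddSubmonoid (L d) → ℤ, ∀ H, f H = (if ZP.Fc Δ z = ZP.Fc Δ x then
            (inc Q ε (ZP.Gc Δ z) H * inc Q ε H (ZP.Gc Δ x)) else 0) +
          (if ZP.Gc Δ z = H then (-1) ^ faceDim (ZP.Gc Δ z) * inc Q ε (ZP.Fc Δ x) (ZP.Fc Δ z) *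
            inc Q ε (ZP.Gc Δ z) (ZP.Gc Δ x) else 0) := ⟨_, fun _ => rfl⟩
  have e : ∀ y, tz Q ε x y * tz Q ε y z =
      (if ZP.Gc Δ y = ZP.Gc Δ x then f1 (ZP.Fc Δ y) else 0) +
      (if ZP.Fc Δ y = ZP.Fc Δ x then f2 (ZP.Gc Δ y) else 0) := by
    intro y
    rw [hf1, hf2]
    have hs : ((-1 : ℤ) ^ faceDim (ZP.Gc Δ x)) * (-1) ^ faceDim (ZP.Gc Δ x) = 1 := by
      rw [← mul_pow]; simp
    unfold tz
    rw [add_mul]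
    congr 1
    · by_cases h1 : ZP.Gc Δ y = ZP.Gc Δ x
      · simp only [h1, if_true]
        rw [mul_add]
        congr 1
        · split_ifs
          · linear_combination (inc Q ε (ZP.Fc Δ x) (ZP.Fc Δ y) *
              inc Q ε (ZP.Fc Δ y) (ZP.Fc Δ z)) * hs
          · simp
        · split_ifs with h2
          · rw [h2]
          · simp
      · simp [h1]
    · by_cases h1 : ZP.Fc Δ y = ZP.Fc Δ x
      · simp only [h1, if_true]
        rw [mul_add, add_comm]
        congr 1
        · split_ifs
          · ring
          · simp
        · split_ifs with h2
          · rw [h2]; ring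
          · simp
      · simp [h1]
  rw [Finset.sum_congr rfl fun y _ => e y, Finset.sum_add_distrib, sumF hx, sumG]
  simp only [hf1, hf2]
  rw [Finset.sum_add_distrib, Finset.sum_add_distrib]
  have h1 : ∑ H ∈ Δ.filter (fun H => ZP.Gc Δ x ≤ H), (if ZP.Gc Δ z = ZP.Gc Δ x then
            (inc Q ε (ZP.Fc Δ x) H * inc Q ε H (ZP.Fc Δ z)) else 0) = 0 := by
    by_cases h : ZP.Gc Δ z = ZP.Gc Δ x
    · simp only [h, if_true]
      refine hM.inc_sq hε _ fun H a b => ?_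
      rw [Finset.mem_filter]
      exact ⟨hΔ.2 _ z.memF _ a.2.1 b.2.2.1, x.le'.trans a.2.2.1⟩
    · simp [h]
  have h2 : ∑ H ∈ Δ.filter (fun H => A ≤ H ∧ H ≤ ZP.Fc Δ x), (if ZP.Fc Δ z = ZP.Fc Δ x then
            (inc Q ε (ZP.Gc Δ z) H * inc Q ε H (ZP.Gc Δ x)) else 0) = 0 := by
    by_cases h : ZP.Fc Δ z = ZP.Fc Δ x
    · simp only [h, if_true]
      refine hM.inc_sq hε _ fun H a b => ?_
      rw [Finset.mem_filter]
      exact ⟨hΔ.2 _ x.memG _ a.2.1 b.2.2.1, (mem_XA.1 hz).trans a.2.2.1, b.2.2.1.trans x.le'⟩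
    · simp [h]
  rw [h1, h2, zero_add, zero_add, Finset.sum_ite_eq, Finset.sum_ite_eq]
  by_cases hF : inc Q ε (ZP.Fc Δ x) (ZP.Fc Δ z) = 0
  · simp [hF]
  by_cases hG : inc Q ε (ZP.Gc Δ z) (ZP.Gc Δ x) = 0
  · simp [hG]
  have fF := inc_ne hF
  have fG := inc_ne hG
  rw [if_pos, if_pos, ← fG.2.2.2, pow_succ]
  · ring
  · rw [Finset.mem_filter]
    exact ⟨z.memG, mem_XA.1 hz, fG.2.2.1.trans x.le'⟩
  · rw [Finset.mem_filter]
    exact ⟨z.memF, x.le'.trans fF.2.2.1⟩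

lemma tz_ne {x y : ZP Δ} (h : tz Q ε x y ≠ 0) : ZP.Fc Δ x ≤ ZP.Fc Δ y ∧
    faceDim (ZP.Fc Δ y) + faceDim (ZP.Gc Δ x) =
      faceDim (ZP.Fc Δ x) + faceDim (ZP.Gc Δ y) + 1 := by
  by_cases h1 : ZP.Gc Δ y = ZP.Gc Δ x ∧ inc Q ε (ZP.Fc Δ x) (ZP.Fc Δ y) ≠ 0
  · have f := inc_ne h1.2
    refine ⟨f.2.2.1, ?_⟩
    have := f.2.2.2
    rw [h1.1]; omega
  by_cases h2 : ZP.Fc Δ y = ZP.Fc Δ x ∧ inc Q ε (ZP.Gc Δ y) (ZP.Gc Δ x) ≠ 0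
  · have f := inc_ne h2.2
    refine ⟨h2.1.ge, ?_⟩
    have := f.2.2.2
    rw [h2.1]; omega
  exfalso
  apply h
  unfold tz
  split_ifs with a b b
  · simp_all
  · simp_all
  · simp_all
  · rfl

/-- The pairs above `A` whose first component is not `A`. -/
def XA' (Δ : Finset (AddSubmonoid (L d))) (A : AddSubmonoid (L d)) : Finset (ZP Δ) :=
  (XA Δ A).filter fun x => ZP.Fc Δ x ≠ A

lemma XA'_acyc (K : Type) [Field K] (hM : Desc Q M) (hε : IsIncidence Q ε)
    (hΔ : IsPolyhedralComplex Q Δ) {A : AddSubmonoid (L d)} (hA : IsFace Q A) :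
    Acyc (fun x y : ZP Δ => ((tz Q ε x y : ℤ) : K)) (XA' Δ A) := by
  have hAx : ∀ x ∈ XA Δ A, A ≤ ZP.Fc Δ x := fun x hx => (mem_XA.1 hx).trans x.le'
  refine Acyc.of_fibres (fun x => ZP.Fc Δ x) _ _ rfl ?_ ?_ ?_
  · intro x _ y _ h
    refine (tz_ne (Q := Q) (ε := ε) (x := x) (y := y) ?_).1
    intro h0
    exact h (by simp [h0])
  · intro x hx z hz
    unfold XA' at hx hz ⊢
    rw [Finset.sum_filter]
    have h := congrArg (fun z : ℤ => (z : K))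
      (tz_sq hM hε hΔ (Finset.mem_filter.1 hx).1 (Finset.mem_filter.1 hz).1)
    simp only [Int.cast_sum, Int.cast_mul, Int.cast_zero] at h
    refine Eq.trans (Finset.sum_congr rfl fun y hy => ?_) h
    split_ifs with hy'
    · rfl
    · have : tz Q ε x y = 0 := by
        by_contra hn
        rw [ne_eq, not_not] at hy'
        have := (tz_ne hn).1
        rw [hy'] at this
        exact (Finset.mem_filter.1 hx).2 (le_antisymm this (hAx x (Finset.mem_filter.1 hx).1))
      rw [this]; simp
  · intro x0 hx0 T hT
    have hx1 := Finset.mem_filter.1 hx0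
    have hac := hM.interval_acyc K hε hΔ hA x0.memF (hAx x0 hx1.1) hx1.2
    set P := ZP.Fc Δ x0 with hP
    have hle : ∀ G : AddSubmonoid (L d), G ∈ Δ.filter (fun G => A ≤ G ∧ G ≤ P) →
      G ∈ Δ ∧ A ≤ G ∧ G ≤ P := fun G hG => Finset.mem_filter.1 hG
    let f : AddSubmonoid (L d) → AddSubmonoid (L d) × AddSubmonoid (L d) := fun G => (P, G)
    -- transport along the injection
    intro c hc
    obtain ⟨b, hb⟩ := hac (fun G => if h : G ∈ Δ ∧ G ≤ P then c (zp x0.memF h.1 h.2) else 0) (by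
      intro G' hG'
      obtain ⟨g1, g2, g3⟩ := hle G' hG'
      rw [← hc (zp x0.memF g1 g3) ((hT _).2 ⟨Finset.mem_filter.2 ⟨mem_XA.2 g2, hx1.2⟩, rfl⟩)]
      symm
      refine Finset.sum_bij (fun y _ => ZP.Gc Δ y) ?_ ?_ ?_ ?_
      · intro y hy
        obtain ⟨h1, h2⟩ := (hT y).1 hy
        rw [Finset.mem_filter]
        exact ⟨y.memG, mem_XA.1 (Finset.mem_filter.1 h1).1, h2 ▸ y.le'⟩
      · intro y hy z hz h
        exact ZP.ext' (((hT y).1 hy).2.trans ((hT z).1 hz).2.symm) h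
      · intro G hG
        obtain ⟨g1, g2, g3⟩ := hle G hG
        exact ⟨zp x0.memF g1 g3, (hT _).2 ⟨Finset.mem_filter.2 ⟨mem_XA.2 g2, hx1.2⟩, rfl⟩, rfl⟩
      · intro y hy
        obtain ⟨h1, h2⟩ := (hT y).1 hy
        have hyP : ZP.Fc Δ y = P := h2
        have hyle : ZP.Gc Δ y ≤ P := hyP ▸ y.le'
        rw [dif_pos ⟨y.memG, hyle⟩]
        have hy' : y = zp x0.memF y.memG hyle := ZP.ext' h2 rfl
        rw [← hy']
        congr 1
        simp only [tz, tV]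
        have e1 : ZP.Fc Δ (zp x0.memF g1 g3) = P := rfl
        have e2 : ZP.Gc Δ (zp x0.memF g1 g3) = G' := rfl
        rw [e1, e2, hyP, inc_self]
        simp)
    refine ⟨fun y => b (ZP.Gc Δ y), fun y hy => ?_⟩
    obtain ⟨h1, h2⟩ := (hT y).1 hy
    have hyP : ZP.Fc Δ y = P := h2
    have := hb (ZP.Gc Δ y) (Finset.mem_filter.2
      ⟨y.memG, mem_XA.1 (Finset.mem_filter.1 h1).1, h2 ▸ y.le'⟩)
    have hyle : ZP.Gc Δ y ≤ P := hyP ▸ y.le'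
    rw [dif_pos ⟨y.memG, hyle⟩] at this
    have hy' : y = zp x0.memF y.memG hyle := ZP.ext' h2 rfl
    rw [← hy'] at this
    rw [← this]
    refine Finset.sum_bij (fun y _ => ZP.Gc Δ y) ?_ ?_ ?_ ?_
    · intro y hy
      obtain ⟨h1, h2⟩ := (hT y).1 hy
      rw [Finset.mem_filter]
      exact ⟨y.memG, mem_XA.1 (Finset.mem_filter.1 h1).1, h2 ▸ y.le'⟩
    · intro y hy z hz h
      exact ZP.ext' (((hT y).1 hy).2.trans ((hT z).1 hz).2.symm) h
    · intro G hG
      obtain ⟨g1, g2, g3⟩ := hle G hG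
      exact ⟨zp x0.memF g1 g3, (hT _).2 ⟨Finset.mem_filter.2 ⟨mem_XA.2 g2, hx1.2⟩, rfl⟩, rfl⟩
    · intro z hz
      obtain ⟨h1, h2⟩ := (hT z).1 hz
      have hzP : ZP.Fc Δ z = P := h2
      congr 1
      simp only [tz, tV]
      rw [hzP, hyP, inc_self]
      simp

/-- Total degree `m`. -/
def hasDeg (m : ℕ) (x : ZP Δ) : Prop := faceDim (ZP.Fc Δ x) = faceDim (ZP.Gc Δ x) + m

lemma mem_XA'_of_deg {A : AddSubmonoid (L d)} {m : ℕ} {x : ZP Δ} (hx : x ∈ XA Δ A)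
    (h : hasDeg (m+1) x) : x ∈ XA' Δ A := by
  refine Finset.mem_filter.2 ⟨hx, fun hA => ?_⟩
  have : ZP.Gc Δ x = ZP.Fc Δ x := le_antisymm x.le' (hA ▸ mem_XA.1 hx)
  unfold hasDeg at h
  rw [this] at h
  omega

lemma tot_exact (K : Type) [Field K] (hM : Desc Q M) (hε : IsIncidence Q ε)
    (hΔ : IsPolyhedralComplex Q Δ) {A : AddSubmonoid (L d)} (hA : IsFace Q A) (m : ℕ)
    (c : ZP Δ → K) (hc0 : ∀ x, ¬ hasDeg (m+1) x → c x = 0)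
    (hc : ∀ y ∈ XA Δ A, ∑ x ∈ XA Δ A, c x * ((tz Q ε x y : ℤ) : K) = 0) :
    ∃ b : ZP Δ → K, (∀ x, ¬ hasDeg m x → b x = 0) ∧
      ∀ y ∈ XA Δ A, ∑ x ∈ XA Δ A, b x * ((tz Q ε x y : ℤ) : K) = if hasDeg (m+1) y then c y
        else 0 := by
  obtain ⟨b, hb⟩ := XA'_acyc K hM hε hΔ hA c (by
    intro y hy
    rw [← hc y (Finset.mem_filter.1 hy).1]
    refine Finset.sum_subset (Finset.filter_subset _ _) fun x hx hx' => ?_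
    rw [hc0 x fun h => hx' (mem_XA'_of_deg hx h), zero_mul])
  refine ⟨fun x => if x ∈ XA' Δ A ∧ hasDeg m x then b x else 0, ?_, ?_⟩
  · intro x hx
    exact if_neg fun h => hx h.2
  · intro y hy
    have key : ∀ x, hasDeg m x → ¬ hasDeg (m+1) y → tz Q ε x y = 0 := by
      intro x hx hy
      by_contra h
      have := (tz_ne h).2
      unfold hasDeg at hx hy
      omega
    split_ifs with hd
    · rw [← hb y (mem_XA'_of_deg hy hd)]
      symm
      refine Finset.sum_subset_zero_on_sdiff (Finset.filter_subset _ _) ?_ ?_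
      · intro x hx
        beta_reduce
        rw [if_neg fun h => (Finset.mem_sdiff.1 hx).2 h.1, zero_mul]
      · intro x hx
        by_cases hxd : hasDeg m x
        · beta_reduce
          rw [if_pos ⟨hx, hxd⟩]
        · have : tz Q ε x y = 0 := by
            by_contra h
            have := (tz_ne h).2
            unfold hasDeg at hd hxd
            omega
          simp [this]
    · refine Finset.sum_eq_zero fun x hx => ?_
      by_cases hxd : hasDeg m x
      · simp [key x hxd hd]
      · beta_reduce
        rw [if_neg fun h => hxd h.2, zero_mul]

/-- The sign of the augmentation. -/
def sg (F : AddSubmonoid (L d)) : ℤ := (-1) ^ (faceDim F * (faceDim F + 1) / 2)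

/-- The augmentation vector. -/
def augv (x : ZP Δ) : ℤ := if ZP.Fc Δ x = ZP.Gc Δ x then sg (ZP.Fc Δ x) else 0

lemma sg_facet {G F : AddSubmonoid (L d)} (h : IsFacetOf Q G F) :
    sg F = - (sg G * (-1) ^ faceDim G) := by
  unfold sg
  rw [← h.2.2.2, ← pow_add]
  have e : ∀ n : ℕ, -((-1 : ℤ) ^ n) = (-1) ^ (n + 1) := fun n => by ring
  rw [e]
  congr 1
  have : (faceDim G + 1) * (faceDim G + 1 + 1) =
    faceDim G * (faceDim G + 1) + 2 * (faceDim G + 1) := by ring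
  omega

lemma augv_cycle (A : AddSubmonoid (L d)) {y : ZP Δ} (hy : y ∈ XA Δ A) :
    ∑ x ∈ XA Δ A, augv x * tz Q ε x y = 0 := by
  have e : ∀ x : ZP Δ, augv x * tz Q ε x y =
      (if x = zp y.memG y.memG le_rfl then sg (ZP.Gc Δ y) * ((-1) ^ faceDim (ZP.Gc Δ y) *
        inc Q ε (ZP.Gc Δ y) (ZP.Fc Δ y)) else 0) +
      (if x = zp y.memF y.memF le_rfl then sg (ZP.Fc Δ y) * inc Q ε (ZP.Gc Δ y) (ZP.Fc Δ y)
        else 0) := by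
    intro x
    unfold augv tz
    by_cases h : ZP.Fc Δ x = ZP.Gc Δ x
    · rw [if_pos h, mul_add]
      congr 1
      · by_cases h1 : ZP.Gc Δ y = ZP.Gc Δ x
        · have hx : x = zp y.memG y.memG le_rfl := ZP.ext' (h.trans h1.symm) h1.symm
          rw [if_pos h1, if_pos hx, ← h1, h, ← h1]
        · rw [if_neg h1, if_neg, mul_zero]
          rintro rfl
          exact h1 rfl
      · by_cases h1 : ZP.Fc Δ y = ZP.Fc Δ x
        · have hx : x = zp y.memF y.memF le_rfl := ZP.ext' h1.symm (h.symm.trans h1.symm)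
          rw [if_pos h1, if_pos hx, h1, h]
        · rw [if_neg h1, if_neg, mul_zero]
          rintro rfl
          exact h1 rfl
    · have h1 : ¬ x = zp y.memG y.memG le_rfl := by rintro rfl; exact h rfl
      have h2 : ¬ x = zp y.memF y.memF le_rfl := by rintro rfl; exact h rfl
      rw [if_neg h, if_neg h1, if_neg h2]; simp
  rw [Finset.sum_congr rfl fun x _ => e x, Finset.sum_add_distrib, Finset.sum_ite_eq',
    Finset.sum_ite_eq', if_pos, if_pos]
  · by_cases h : inc Q ε (ZP.Gc Δ y) (ZP.Fc Δ y) = 0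
    · simp [h]
    · rw [sg_facet (inc_ne h)]; ring
  · exact mem_XA.2 ((mem_XA.1 hy).trans y.le')
  · have := mem_XA.1 hy
    exact mem_XA.2 this

lemma tot_exact0 (K : Type) [Field K] (hM : Desc Q M) (hε : IsIncidence Q ε)
    (hΔ : IsPolyhedralComplex Q Δ) {A : AddSubmonoid (L d)} (hA : IsFace Q A)
    (c : ZP Δ → K)
    (hc : ∀ y ∈ XA Δ A, ∑ x ∈ XA Δ A, c x * ((tz Q ε x y : ℤ) : K) = 0) :
    ∃ c0 : K, ∀ y ∈ XA Δ A, hasDeg 0 y → c y = c0 * ((augv y : ℤ) : K) := by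
  by_cases hAΔ : A ∈ Δ
  swap
  · exact ⟨0, fun y hy => absurd (hΔ.2 _ y.memG A hA (mem_XA.1 hy)) hAΔ⟩
  set a := zp hAΔ hAΔ le_rfl with ha
  have hsg : ((augv a : ℤ) : K) * ((augv a : ℤ) : K) = 1 := by
    have : augv a = sg A := if_pos rfl
    rw [this, ← Int.cast_mul]
    unfold sg
    rw [← mul_pow]
    simp
  have ha' : ∀ x ∈ XA Δ A, x ∉ XA' Δ A → x = a := by
    intro x hx hx'
    have h1 : ZP.Fc Δ x = A := by
      by_contra h
      exact hx' (Finset.mem_filter.2 ⟨hx, h⟩)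
    have h2 : ZP.Gc Δ x ≤ A := h1 ▸ x.le'
    exact ZP.ext' h1 (le_antisymm h2 (mem_XA.1 hx))
  refine ⟨c a * ((augv a : ℤ) : K), ?_⟩
  set c' : ZP Δ → K := fun x => c x - c a * ((augv a : ℤ) : K) * ((augv x : ℤ) : K) with hc'
  have hca : c' a = 0 := by
    simp only [hc']
    rw [mul_assoc, hsg, mul_one, sub_self]
  obtain ⟨b, hb⟩ := XA'_acyc K hM hε hΔ hA c' (by
    intro y hy
    have hyX := (Finset.mem_filter.1 hy).1
    have h1 : ∑ x ∈ XA Δ A, c' x * ((tz Q ε x y : ℤ) : K) = 0 := by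
      simp only [hc', sub_mul, Finset.sum_sub_distrib]
      rw [hc y hyX, zero_sub, neg_eq_zero]
      have h := congrArg (fun z : ℤ => (z : K)) (augv_cycle (Q := Q) (ε := ε) A hyX)
      simp only [Int.cast_sum, Int.cast_mul, Int.cast_zero] at h
      simp only [mul_assoc, ← Finset.mul_sum]
      rw [h]; ring
    rw [← h1]
    refine Finset.sum_subset (Finset.filter_subset _ _) fun x hx hx' => ?_
    rw [ha' x hx hx', hca, zero_mul])
  intro y hy hd
  have : c' y = 0 := by
    by_cases hy' : y ∈ XA' Δ A
    · rw [← hb y hy']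
      refine Finset.sum_eq_zero fun x _ => ?_
      have : tz Q ε x y = 0 := by
        by_contra h
        have := (tz_ne h).2
        have h2 : faceDim (ZP.Gc Δ x) ≤ faceDim (ZP.Fc Δ x) := by
          rcases x.le'.lt_or_eq with h3 | h3
          · exact (faceDim_lt (hΔ.1 _ x.memG) (hΔ.1 _ x.memF) h3).le
          · rw [h3]
        unfold hasDeg at hd
        omega
      simp [this]
    · rw [ha' y hy hy', hca]
  exact sub_eq_zero.1 this

end

/-! ### Monomial ideals and coefficients -/

section
variable {k : Type} [Field k] {d : ℕ} {Q : AddSubmonoid (L d)} {M : Finset (L d →ₗ[ℤ] ℤ)}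
  {Δ : Finset (AddSubmonoid (L d))} {ε : AddSubmonoid (L d) → AddSubmonoid (L d) → ℤ}

lemma mem_span_mono (S : Set Q) (hS : ∀ q ∈ S, ∀ r : Q, r + q ∈ S) (f : kQ k Q) :
    f ∈ Ideal.span {m | ∃ q : Q, q ∈ S ∧ m = mono k Q q} ↔ ∀ q, q ∉ S → f.coeff q = 0 := by
  have e : {m | ∃ q : Q, q ∈ S ∧ m = mono k Q q} = AddMonoidAlgebra.of' k Q '' S := by
    ext m
    constructor
    · rintro ⟨q, hq, rfl⟩; exact ⟨q, hq, rfl⟩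
    · rintro ⟨q, hq, rfl⟩; exact ⟨q, hq, rfl⟩
  rw [e, AddMonoidAlgebra.mem_ideal_span_of'_image]
  constructor
  · intro h q hq
    by_contra hne
    obtain ⟨m', hm', r, rfl⟩ := h q (Finsupp.mem_support_iff.2 hne)
    exact hq (hS m' hm' r)
  · intro h q hq
    by_cases hqS : q ∈ S
    · exact ⟨q, hqS, 0, (zero_add q).symm⟩
    · exact absurd (h q hqS) (Finsupp.mem_support_iff.1 hq)

lemma IsFace.mem_of_add {G : AddSubmonoid (L d)} (hG : IsFace Q G) {q r : L d} (hq : q ∈ Q)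
    (hr : r ∈ Q) (h : r + q ∈ G) : q ∈ G := by
  obtain ⟨lam, h0, h1⟩ := hG
  have e : ∀ x, x ∈ G ↔ x ∈ Q ∧ lam x = 0 := fun x => by
    rw [← SetLike.mem_coe, h1]; rfl
  rw [e] at h ⊢
  have := h.2
  rw [map_add] at this
  have a := h0 q hq
  have b := h0 r hr
  exact ⟨hq, by omega⟩

lemma mem_facePrime {G : AddSubmonoid (L d)} (hG : IsFace Q G) (f : kQ k Q) :
    f ∈ facePrime k Q G ↔ ∀ q : Q, (q : L d) ∈ G → f.coeff q = 0 := by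
  have h := mem_span_mono (k := k) {q : Q | (q : L d) ∉ G}
    (fun q hq r h => hq (hG.mem_of_add q.2 r.2 h)) f
  refine Iff.trans h ?_
  simp only [Set.mem_ofPred_eq, not_not]

lemma mem_complexIdeal (hΔ : IsPolyhedralComplex Q Δ) (f : kQ k Q) :
    f ∈ complexIdeal k Q Δ ↔ ∀ F ∈ Δ, ∀ q : Q, (q : L d) ∈ F → f.coeff q = 0 := by
  have h := mem_span_mono (k := k) {q : Q | ∀ F ∈ Δ, (q : L d) ∉ F}
    (fun q hq r F hF h => hq F hF ((hΔ.1 F hF).mem_of_add q.2 r.2 h)) f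
  refine Iff.trans h ?_
  simp only [Set.mem_ofPred_eq, not_forall, not_not]
  constructor
  · intro h F hF q hq; exact h q ⟨F, hF, hq⟩
  · rintro h q ⟨F, hF, hq⟩; exact h F hF q hq

/-- Restriction of monomials to a face. -/
def resG {G : AddSubmonoid (L d)} (hG : IsFace Q G) : Multiplicative Q →* kQ k Q where
  toFun q := if ((Multiplicative.toAdd q : Q) : L d) ∈ G then
    AddMonoidAlgebra.single (Multiplicative.toAdd q) 1 else 0
  map_one' := by
    rw [if_pos]
    · rfl
    · exact G.zero_mem
  map_mul' a b := by
    by_cases ha : ((Multiplicative.toAdd a : Q) : L d) ∈ G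
    · by_cases hb : ((Multiplicative.toAdd b : Q) : L d) ∈ G
      · rw [if_pos ha, if_pos hb, if_pos, AddMonoidAlgebra.single_mul_single, one_mul]
        · rfl
        · exact G.add_mem ha hb
      · rw [if_neg hb, mul_zero, if_neg]
        intro h
        exact hb (hG.mem_of_add (Subtype.mem _) (Subtype.mem _) h)
    · rw [if_neg ha, zero_mul, if_neg]
      intro h
      rw [toAdd_mul, AddSubmonoid.coe_add, add_comm] at h
      exact ha (hG.mem_of_add (Subtype.mem _) (Subtype.mem _) h)

lemma resG_coeff {G : AddSubmonoid (L d)} (hG : IsFace Q G) (f : kQ k Q) (q : Q) :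
    (AddMonoidAlgebra.lift k (kQ k Q) Q (resG (k := k) hG) f).coeff q =
      if (q : L d) ∈ G then f.coeff q else 0 := by
  induction f using AddMonoidAlgebra.induction_linear with
  | zero => simp
  | add f g hf hg =>
    rw [map_add, AddMonoidAlgebra.coeff_add, AddMonoidAlgebra.coeff_add, Finsupp.add_apply, hf, hg]
    split_ifs <;> simp
  | single a r =>
    rw [AddMonoidAlgebra.lift_single]
    simp only [resG, MonoidHom.coe_mk, OneHom.coe_mk, toAdd_ofAdd]
    by_cases ha : (a : L d) ∈ G
    · rw [if_pos ha]
      rw [AddMonoidAlgebra.coeff_smul, AddMonoidAlgebra.coeff_single, AddMonoidAlgebra.coeff_single,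
        Finsupp.smul_single, smul_eq_mul, mul_one]
      by_cases haq : a = q
      · subst haq; rw [if_pos ha]
      · rw [Finsupp.single_eq_of_ne (Ne.symm haq)]; simp
    · rw [if_neg ha, smul_zero, AddMonoidAlgebra.coeff_zero, Finsupp.zero_apply]
      split_ifs with hq
      · rw [AddMonoidAlgebra.coeff_single, Finsupp.single_eq_of_ne]
        rintro rfl; exact ha hq
      · rfl

lemma kQ_noZeroDivisors : NoZeroDivisors (kQ k Q) := by
  haveI : TwoUniqueSums Q :=
    TwoUniqueSums.of_injective_addHom (Q.subtype : Q →+ L d).toAddHom Subtype.val_injective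
      inferInstance
  infer_instance

lemma facePrime_prime {G : AddSubmonoid (L d)} (hG : IsFace Q G) :
    (facePrime k Q G).IsPrime := by
  haveI := kQ_noZeroDivisors (k := k) (Q := Q)
  haveI : IsDomain (kQ k Q) := NoZeroDivisors.to_isDomain _
  have : facePrime k Q G =
      RingHom.ker (AddMonoidAlgebra.lift k (kQ k Q) Q (resG (k := k) hG)) := by
    ext f
    rw [mem_facePrime hG, RingHom.mem_ker]
    constructor
    · intro h
      apply AddMonoidAlgebra.coeff_injective
      ext q
      rw [resG_coeff]
      split_ifs with hq
      · rw [h q hq]; rfl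
      · rfl
    · intro h q hq
      have := resG_coeff hG f q
      rw [h, if_pos hq] at this
      rw [← this]; rfl
  rw [this]
  exact RingHom.ker_isPrime _

lemma facePrime_props {G : AddSubmonoid (L d)} (hG : IsFace Q G) :
    IsMonomialIdeal k Q (facePrime k Q G) ∧ IsIrreducibleIdeal k Q (facePrime k Q G) := by
  constructor
  · refine ⟨{q : Q | (q : L d) ∉ G}, ?_⟩
    unfold facePrime
    congr 1
    ext m
    constructor
    · rintro ⟨q, hq, rfl⟩; exact ⟨q, hq, rfl⟩
    · rintro ⟨q, hq, rfl⟩; exact ⟨q, hq, rfl⟩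
  · intro W₁ W₂ h
    have hp := facePrime_prime (k := k) hG
    rcases (hp.inf_le (I := W₁) (J := W₂)).1 h.ge with h1 | h1
    · exact Or.inl (le_antisymm (h.le.trans inf_le_left) h1)
    · exact Or.inr (le_antisymm (h.le.trans inf_le_right) h1)

/-! ### Explicit description of the total complex -/

/-- The element of `tot^m` with given representatives. -/
def asm (m : ℕ) (f : TIdx Δ m → kQ k Q) : TMod k Q Δ m :=
  ∑ x, DirectSum.lof (kQ k Q) (TIdx Δ m) (fun x => kQ k Q ⧸ facePrime k Q (ZP.Gc Δ x.1)) x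
    (Submodule.Quotient.mk (f x))

lemma asm_surj (m : ℕ) (u : TMod k Q Δ m) : ∃ f, asm m f = u := by
  refine ⟨fun x => (Submodule.Quotient.mk_surjective _ (u x)).choose, ?_⟩
  unfold asm
  conv_rhs => rw [← DirectSum.sum_univ_of u]
  refine Finset.sum_congr rfl fun x _ => ?_
  rw [(Submodule.Quotient.mk_surjective _ (u x)).choose_spec]
  rfl

lemma asm_apply (m : ℕ) (f : TIdx Δ m → kQ k Q) (x : TIdx Δ m) :
    asm m f x = Submodule.Quotient.mk (f x) := by
  unfold asm
  rw [DFinsupp.finsetSum_apply, Finset.sum_eq_single x]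
  · exact DirectSum.of_eq_same x _
  · intro y _ hy
    exact DirectSum.of_eq_of_ne y x _ (Ne.symm hy)
  · intro h; exact absurd (Finset.mem_univ _) h

lemma asm_eq_zero (hΔ : IsPolyhedralComplex Q Δ) (m : ℕ) (f : TIdx Δ m → kQ k Q) :
    asm m f = 0 ↔ ∀ (x : TIdx Δ m) (q : Q), (q : L d) ∈ ZP.Gc Δ x.1 → (f x).coeff q = 0 := by
  have : asm m f = 0 ↔ ∀ x, asm m f x = 0 := by
    constructor
    · intro h x; rw [h]; rfl
    · intro h; exact DFinsupp.ext h
  rw [this]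
  refine forall_congr' fun x => ?_
  rw [asm_apply, Submodule.Quotient.mk_eq_zero]
  exact mem_facePrime (hΔ.1 _ x.1.memG) (f x)

lemma asm_eq (hΔ : IsPolyhedralComplex Q Δ) (m : ℕ) (f g : TIdx Δ m → kQ k Q) :
    asm m f = asm m g ↔ ∀ (x : TIdx Δ m) (q : Q), (q : L d) ∈ ZP.Gc Δ x.1 →
      (f x).coeff q = (g x).coeff q := by
  have : asm m f = asm m g ↔ ∀ x, asm m f x = asm m g x := by
    constructor
    · intro h x; rw [h]
    · intro h; exact DFinsupp.ext h
  rw [this]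
  refine forall_congr' fun x => ?_
  rw [asm_apply, asm_apply, Submodule.Quotient.eq]
  refine (mem_facePrime (hΔ.1 _ x.1.memG) (f x - g x)).trans ?_
  refine forall_congr' fun q => forall_congr' fun _ => ?_
  rw [AddMonoidAlgebra.coeff_sub, Finsupp.sub_apply, sub_eq_zero]

/-- The differential on representatives. -/
def DD (Q : AddSubmonoid (L d)) (ε : AddSubmonoid (L d) → AddSubmonoid (L d) → ℤ) (m : ℕ)
    (f : TIdx Δ m → kQ k Q) : TIdx Δ (m+1) → kQ k Q :=
  fun y => ∑ x, tz Q ε x.1 y.1 • f x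

lemma tdiff_asm (m : ℕ) (f : TIdx Δ m → kQ k Q) :
    tdiff k Q Δ ε m (asm m f) = asm (m+1) (DD Q ε m f) := by
  have e : ∀ x : TIdx Δ m, tdiff k Q Δ ε m (DirectSum.lof (kQ k Q) (TIdx Δ m)
      (fun x => kQ k Q ⧸ facePrime k Q (ZP.Gc Δ x.1)) x (Submodule.Quotient.mk (f x))) =
      ∑ y : TIdx Δ (m+1), tz Q ε x.1 y.1 • DirectSum.lof (kQ k Q) (TIdx Δ (m+1))
      (fun x => kQ k Q ⧸ facePrime k Q (ZP.Gc Δ x.1)) y (Submodule.Quotient.mk (f x)) := by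
    intro x
    unfold tdiff
    rw [DirectSum.toModule_lof, LinearMap.add_apply, LinearMap.sum_apply, LinearMap.sum_apply,
      ← Finset.sum_add_distrib]
    refine Finset.sum_congr rfl fun y _ => ?_
    unfold tz
    rw [add_smul]
    congr 1
    · by_cases h1 : ZP.Gc Δ y.1 = ZP.Gc Δ x.1
      · by_cases h2 : IsFacetOf Q (ZP.Fc Δ x.1) (ZP.Fc Δ y.1)
        · rw [dif_pos ⟨h1, h2⟩, if_pos h1, inc, if_pos h2]
          rfl
        · rw [dif_neg fun h => h2 h.2, if_pos h1, inc, if_neg h2, mul_zero, zero_smul]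
          rfl
      · rw [dif_neg fun h => h1 h.1, if_neg h1, zero_smul]
        rfl
    · by_cases h1 : ZP.Fc Δ y.1 = ZP.Fc Δ x.1
      · by_cases h2 : IsFacetOf Q (ZP.Gc Δ y.1) (ZP.Gc Δ x.1)
        · rw [dif_pos ⟨h1, h2⟩, if_pos h1, inc, if_pos h2]
          rfl
        · rw [dif_neg fun h => h2 h.2, if_pos h1, inc, if_neg h2, zero_smul]
          rfl
      · rw [dif_neg fun h => h1 h.1, if_neg h1, zero_smul]
        rfl
  unfold asm
  rw [map_sum, Finset.sum_congr rfl fun x _ => e x, Finset.sum_comm]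
  refine Finset.sum_congr rfl fun y _ => ?_
  unfold DD
  rw [← Submodule.mkQ_apply, map_sum, map_sum]
  refine Finset.sum_congr rfl fun x _ => ?_
  rw [map_zsmul, map_zsmul]
  rfl

lemma totAug_eq (f : kQ k Q) : totAug k Q Δ f = asm 0 (fun x => augv x.1 • f) := by
  unfold totAug asm
  rw [LinearMap.sum_apply]
  refine Finset.sum_congr rfl fun x _ => ?_
  by_cases h : ZP.Fc Δ x.1 = ZP.Gc Δ x.1
  · have h1 : augv x.1 = sg (ZP.Fc Δ x.1) := if_pos h
    beta_reduce
    rw [if_pos h, h1, ← Submodule.mkQ_apply, map_zsmul, map_zsmul]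
    rfl
  · have h1 : augv x.1 = 0 := if_neg h
    beta_reduce
    rw [if_neg h, h1, zero_smul, Submodule.Quotient.mk_zero, map_zero]
    rfl

/-- The degree-`q` coefficients of a family of representatives. -/
def cq (m : ℕ) (f : TIdx Δ m → kQ k Q) (q : Q) (x : ZP Δ) : k :=
  if h : hasDeg m x then (f ⟨x, h⟩).coeff q else 0

lemma cq_of (m : ℕ) (f : TIdx Δ m → kQ k Q) (q : Q) (x : TIdx Δ m) :
    cq m f q x.1 = (f x).coeff q := dif_pos x.2

lemma tz_le {x y : ZP Δ} (h : tz Q ε x y ≠ 0) : ZP.Gc Δ y ≤ ZP.Gc Δ x := by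
  by_cases h1 : ZP.Gc Δ y = ZP.Gc Δ x
  · exact h1.le
  · by_cases h2 : inc Q ε (ZP.Gc Δ y) (ZP.Gc Δ x) = 0
    · simp [tz, h1, h2] at h
    · exact (inc_ne h2).2.2.1

lemma sum_TIdx (m : ℕ) (g : ZP Δ → k) (hg : ∀ x, ¬ hasDeg m x → g x = 0) :
    ∑ x : TIdx Δ m, g x.1 = ∑ x, g x := by
  rw [← Finset.sum_filter_of_ne (p := fun x => hasDeg m x)
    (fun x _ hx => by by_contra h; exact hx (hg x h))]
  symm
  exact Finset.sum_subtype _ (fun x => by rw [Finset.mem_filter]; exact and_iff_right (Finset.mem_univ x)) g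

lemma cq_DD (m : ℕ) (f : TIdx Δ m → kQ k Q) (q : Q) {A : AddSubmonoid (L d)} {y : ZP Δ}
    (hy : y ∈ XA Δ A) :
    cq (m+1) (DD Q ε m f) q y = ∑ x ∈ XA Δ A, cq m f q x * ((tz Q ε x y : ℤ) : k) := by
  have h1 : ∑ x ∈ XA Δ A, cq m f q x * ((tz Q ε x y : ℤ) : k) =
      ∑ x, cq m f q x * ((tz Q ε x y : ℤ) : k) := by
    refine Finset.sum_subset (Finset.subset_univ _) fun x _ hx => ?_
    have : tz Q ε x y = 0 := by
      by_contra h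
      exact hx (mem_XA.2 ((mem_XA.1 hy).trans (tz_le h)))
    simp [this]
  rw [h1]
  by_cases hd : hasDeg (m+1) y
  · rw [← sum_TIdx m _ (fun x hx => by rw [cq, dif_neg hx, zero_mul])]
    rw [cq, dif_pos hd, DD, AddMonoidAlgebra.coeff_sum, Finsupp.finsetSum_apply]
    refine Finset.sum_congr rfl fun x _ => ?_
    rw [cq_of, AddMonoidAlgebra.coeff_smul, Finsupp.smul_apply, zsmul_eq_mul, mul_comm]
  · rw [cq, dif_neg hd]
    symm
    refine Finset.sum_eq_zero fun x _ => ?_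
    by_cases hx : hasDeg m x
    · have : tz Q ε x y = 0 := by
        by_contra h
        have := (tz_ne h).2
        unfold hasDeg at hx hd
        omega
      simp [this]
    · rw [cq, dif_neg hx, zero_mul]

lemma asm_eq_zero' (hΔ : IsPolyhedralComplex Q Δ) (m : ℕ) (f : TIdx Δ m → kQ k Q) :
    asm m f = 0 ↔ ∀ (q : Q) (x : ZP Δ), (q : L d) ∈ ZP.Gc Δ x → cq m f q x = 0 := by
  rw [asm_eq_zero hΔ]
  constructor
  · intro h q x hq
    unfold cq
    split_ifs with hd
    · exact h ⟨x, hd⟩ q hq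
    · rfl
  · intro h x q hq
    rw [← cq_of]; exact h q x.1 hq

lemma asm_eq' (hΔ : IsPolyhedralComplex Q Δ) (m : ℕ) (f g : TIdx Δ m → kQ k Q)
    (h : ∀ (q : Q) (x : ZP Δ), (q : L d) ∈ ZP.Gc Δ x → cq m f q x = cq m g q x) :
    asm m f = asm m g := by
  rw [asm_eq hΔ]
  intro x q hq
  rw [← cq_of, ← cq_of]; exact h q x.1 hq

lemma exact_pos (hM : Desc Q M) (hε : IsIncidence Q ε) (hΔ : IsPolyhedralComplex Q Δ) (m : ℕ) :
    Function.Exact ⇑(tdiff k Q Δ ε m) ⇑(tdiff k Q Δ ε (m+1)) := by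
  have hmin : ∀ q : Q, ∃ A, IsFace Q A ∧ ∀ x : ZP Δ, (q : L d) ∈ ZP.Gc Δ x ↔ x ∈ XA Δ A := by
    intro q
    obtain ⟨A, hA, h⟩ := hM.min_face q.2
    exact ⟨A, hA, fun x => (h _ (hΔ.1 _ x.memG)).trans mem_XA.symm⟩
  intro u
  constructor
  · intro hu
    obtain ⟨g, rfl⟩ := asm_surj m.succ u
    rw [tdiff_asm, asm_eq_zero' hΔ] at hu
    have hb : ∀ q : Q, ∃ b : ZP Δ → k, (∀ x, ¬ hasDeg m x → b x = 0) ∧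
        (∀ A, (∀ x : ZP Δ, (q : L d) ∈ ZP.Gc Δ x ↔ x ∈ XA Δ A) →
        ∀ y ∈ XA Δ A, ∑ x ∈ XA Δ A, b x * ((tz Q ε x y : ℤ) : k) = cq (m+1) g q y) := by
      intro q
      obtain ⟨A, hA, h⟩ := hmin q
      obtain ⟨b, hb0, hb⟩ := tot_exact k hM hε hΔ hA m (cq (m+1) g q)
        (fun x hx => dif_neg hx) (fun y hy => by
          rw [← cq_DD (m+1) g q hy]; exact hu q y ((h y).2 hy))
      refine ⟨b, hb0, fun A' h' y hy => ?_⟩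
      have : XA Δ A' = XA Δ A := by ext x; rw [← h', h]
      rw [this] at hy ⊢
      rw [hb y hy]
      split_ifs with hd
      · rfl
      · rw [cq, dif_neg hd]
    choose b hb0 hb using hb
    let S : Finset Q := Finset.univ.biUnion fun x => (g x).coeff.support
    have hS : ∀ q, q ∉ S → ∀ x, cq (m+1) g q x = 0 := by
      intro q hq x
      unfold cq
      split_ifs with hd
      · by_contra hne
        exact hq (Finset.mem_biUnion.2 ⟨⟨x, hd⟩, Finset.mem_univ _, Finsupp.mem_support_iff.2 hne⟩)
      · rfl
    let f : TIdx Δ m → kQ k Q := fun x => ∑ q ∈ S, AddMonoidAlgebra.single q (b q x.1)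
    have hf : ∀ q x, cq m f q x = if q ∈ S then b q x else 0 := by
      intro q x
      unfold cq
      split_ifs with hd hq hq
      · simp only [f]
        rw [AddMonoidAlgebra.coeff_sum, Finsupp.finsetSum_apply, Finset.sum_eq_single q]
        · rw [AddMonoidAlgebra.coeff_single, Finsupp.single_eq_same]
        · intro q' _ hne
          rw [AddMonoidAlgebra.coeff_single, Finsupp.single_eq_of_ne (Ne.symm hne)]
        · intro h; exact absurd hq h
      · simp only [f]
        rw [AddMonoidAlgebra.coeff_sum, Finsupp.finsetSum_apply]
        refine Finset.sum_eq_zero fun q' hq' => ?_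
        rw [AddMonoidAlgebra.coeff_single, Finsupp.single_eq_of_ne]
        rintro rfl; exact hq hq'
      · exact (hb0 q x hd).symm
      · rfl
    refine ⟨asm m f, ?_⟩
    rw [tdiff_asm]
    refine asm_eq' hΔ _ _ _ fun q y hy => ?_
    obtain ⟨A, hA, h⟩ := hmin q
    have hyX := (h y).1 hy
    rw [cq_DD m f q hyX]
    by_cases hq : q ∈ S
    · rw [← hb q A h y hyX]
      exact Finset.sum_congr rfl fun x _ => by rw [hf, if_pos hq]
    · refine Eq.trans (Finset.sum_eq_zero fun x _ => ?_) (hS q hq y).symm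
      rw [hf, if_neg hq, zero_mul]
  · rintro ⟨v, rfl⟩
    obtain ⟨f, rfl⟩ := asm_surj m v
    rw [tdiff_asm, tdiff_asm, asm_eq_zero' hΔ]
    intro q z hz
    obtain ⟨A, hA, h⟩ := hmin q
    have hzX := (h z).1 hz
    rw [cq_DD (m+1) _ q hzX, Finset.sum_congr rfl fun y hy => by rw [cq_DD m f q hy]]
    simp only [Finset.sum_mul]
    rw [Finset.sum_comm]
    refine Finset.sum_eq_zero fun x hx => ?_
    have h2 := congrArg (fun z : ℤ => (z : k)) (tz_sq hM hε hΔ hx hzX)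
    simp only [Int.cast_sum, Int.cast_mul, Int.cast_zero] at h2
    simp only [mul_assoc, ← Finset.mul_sum]
    rw [h2, mul_zero]

lemma cq_aug (f : kQ k Q) (q : Q) (x : ZP Δ) :
    cq 0 (fun x : TIdx Δ 0 => augv x.1 • f) q x = f.coeff q * ((augv x : ℤ) : k) := by
  unfold cq
  split_ifs with hd
  · rw [AddMonoidAlgebra.coeff_smul, Finsupp.smul_apply, zsmul_eq_mul, mul_comm]
  · have : augv x = 0 := by
      unfold augv
      rw [if_neg]
      intro h
      exact hd (by unfold hasDeg; rw [h]; rfl)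
    simp [this]

lemma exact_zero (hM : Desc Q M) (hε : IsIncidence Q ε) (hΔ : IsPolyhedralComplex Q Δ) :
    Function.Exact ⇑(totAug k Q Δ) ⇑(tdiff k Q Δ ε 0) := by
  have hmin : ∀ q : Q, ∃ A, IsFace Q A ∧ ∀ x : ZP Δ, (q : L d) ∈ ZP.Gc Δ x ↔ x ∈ XA Δ A := by
    intro q
    obtain ⟨A, hA, h⟩ := hM.min_face q.2
    exact ⟨A, hA, fun x => (h _ (hΔ.1 _ x.memG)).trans mem_XA.symm⟩
  intro u
  constructor
  · intro hu
    obtain ⟨g, rfl⟩ := asm_surj 0 u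
    rw [tdiff_asm, asm_eq_zero' hΔ] at hu
    have hb : ∀ q : Q, ∃ b : k, ∀ y : ZP Δ, (q : L d) ∈ ZP.Gc Δ y → hasDeg 0 y →
        cq 0 g q y = b * ((augv y : ℤ) : k) := by
      intro q
      obtain ⟨A, hA, h⟩ := hmin q
      obtain ⟨b, hb⟩ := tot_exact0 k hM hε hΔ hA (cq 0 g q) (fun y hy => by
          rw [← cq_DD 0 g q hy]; exact hu q y ((h y).2 hy))
      exact ⟨b, fun y hy => hb y ((h y).1 hy)⟩
    choose b hb using hb
    let S : Finset Q := Finset.univ.biUnion fun x => (g x).coeff.support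
    have hS : ∀ q, q ∉ S → ∀ x, cq 0 g q x = 0 := by
      intro q hq x
      unfold cq
      split_ifs with hd
      · by_contra hne
        exact hq (Finset.mem_biUnion.2 ⟨⟨x, hd⟩, Finset.mem_univ _, Finsupp.mem_support_iff.2 hne⟩)
      · rfl
    let f : kQ k Q := ∑ q ∈ S, AddMonoidAlgebra.single q (b q)
    have hf : ∀ q, f.coeff q = if q ∈ S then b q else 0 := by
      intro q
      simp only [f]
      rw [AddMonoidAlgebra.coeff_sum, Finsupp.finsetSum_apply]
      split_ifs with hq
      · rw [Finset.sum_eq_single q]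
        · rw [AddMonoidAlgebra.coeff_single, Finsupp.single_eq_same]
        · intro q' _ hne
          rw [AddMonoidAlgebra.coeff_single, Finsupp.single_eq_of_ne (Ne.symm hne)]
        · intro h; exact absurd hq h
      · refine Finset.sum_eq_zero fun q' hq' => ?_
        rw [AddMonoidAlgebra.coeff_single, Finsupp.single_eq_of_ne]
        rintro rfl; exact hq hq'
    refine ⟨f, ?_⟩
    rw [totAug_eq]
    refine asm_eq' hΔ _ _ _ fun q y hy => ?_
    by_cases hd : hasDeg 0 y
    · rw [cq_aug, hf]
      split_ifs with hq
      · exact (hb q y hy hd).symm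
      · rw [zero_mul, hS q hq]
    · rw [cq, cq, dif_neg hd, dif_neg hd]
  · rintro ⟨f, rfl⟩
    rw [totAug_eq, tdiff_asm, asm_eq_zero' hΔ]
    intro q z hz
    obtain ⟨A, hA, h⟩ := hmin q
    have hzX := (h z).1 hz
    rw [cq_DD 0 _ q hzX]
    simp only [cq_aug, mul_assoc, ← Finset.mul_sum]
    have h2 := congrArg (fun z : ℤ => (z : k)) (augv_cycle (Q := Q) (ε := ε) A hzX)
    simp only [Int.cast_sum, Int.cast_mul, Int.cast_zero] at h2
    rw [h2, mul_zero]

lemma ker_aug (hΔ : IsPolyhedralComplex Q Δ) :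
    LinearMap.ker (totAug k Q Δ) = complexIdeal k Q Δ := by
  ext f
  rw [LinearMap.mem_ker, totAug_eq, asm_eq_zero' hΔ, mem_complexIdeal hΔ]
  constructor
  · intro h F hF q hq
    have h1 := h q (zp hF hF le_rfl) hq
    rw [cq_aug] at h1
    have h2 : augv (zp hF hF le_rfl) = sg F := if_pos rfl
    rw [h2] at h1
    rcases mul_eq_zero.1 h1 with h3 | h3
    · exact h3
    · exfalso
      unfold sg at h3
      rw [Int.cast_pow] at h3
      have := eq_zero_of_pow_eq_zero h3
      simp at this
  · intro h q x hq
    rw [cq_aug, h _ x.memG q hq, zero_mul]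

end

/-- **Statement 10.**  The total complex of the Zeeman double complex, with the
augmentation `1 ↦ Σ_{F ∈ Δ} (-1)^{dim F(dim F+1)/2} (F ⊗ e_F)`, is an irreducible
resolution of `k[Q]/I_Δ`: the kernel of the augmentation (from `k[Q]`) is exactly
`I_Δ`, the augmented complex is exact, and each term is a direct sum of quotients
of `k[Q]` by irreducible monomial ideals (the face primes). -/
theorem total_zeeman_complex_is_irreducible_resolution
    (hQ : IsNormalAffineSemigroup Q) (Δ : Finset (AddSubmonoid (L d)))
    (ε : AddSubmonoid (L d) → AddSubmonoid (L d) → ℤ)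
    (hΔ : IsPolyhedralComplex Q Δ) (hε : IsIncidence Q ε) :
    LinearMap.ker (totAug k Q Δ) = complexIdeal k Q Δ ∧
    Function.Exact ⇑(totAug k Q Δ) ⇑(tdiff k Q Δ ε 0) ∧
    (∀ m : ℕ, Function.Exact ⇑(tdiff k Q Δ ε m) ⇑(tdiff k Q Δ ε (m+1))) ∧
    (∀ G : AddSubmonoid (L d), IsFace Q G →
      IsMonomialIdeal k Q (facePrime k Q G) ∧ IsIrreducibleIdeal k Q (facePrime k Q G)) := by
  obtain ⟨M, hM⟩ := exists_desc hQ
  exact ⟨ker_aug hΔ, exact_zero hM hε hΔ, fun m => exact_pos hM hε hΔ m,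
    fun G hG => facePrime_props hG⟩


end ZMS
end
end
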